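/- Let Λ be a finite-dimensional algebra over an algebraically closed field K presented by a quiver whose underlying graph is a tree, with radical square zero, and let T(Λ) = Λ ⋉ DΛ be its trivial extension. If T(Λ) is τ-tilting-finite, then T(Λ) is representation-finite. -/

import Mathlib

/- Formalization of statements from
   "Report on the finiteness of silting objects"
   by T. Aihara, T. Honma, K. Miyamoto, Q. Wang. -/

open CategoryTheory CategoryTheory.Limits

universe u v w

noncomputable section
namespace PaperSilting
/-! ### Module-theoretic notions.

We model right `Λ`-modules as left modules over the opposite ring; all the
definitions below are stated for left modules over a ring `R` and are applied
with `R := Λᵐᵒᵖ`. -/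

/-- The category of `R`-modules (in `Type 0`). -/
abbrev ModCat (R : Type) [Ring R] := ModuleCat.{0} R

variable {R : Type} [Ring R]

/-- The module object `M` is finitely generated. -/
def IsFGMod {R : Type} [Ring R] (M : ModCat R) : Prop := Module.Finite R M

/-- Indecomposable module object. -/
def IsIndecMod {R : Type} [Ring R] (M : ModCat R) : Prop :=
  ¬ IsZero M ∧ ∀ A B : ModCat R, Nonempty (M ≅ A ⊞ B) → IsZero A ∨ IsZero B

/-- `N` belongs to `add M`, i.e. `N` is a direct summand of a finite direct sum
of copies of `M`. -/
def MemAddMod {R : Type} [Ring R] (N M : ModCat R) : Prop :=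
  ∃ (k : ℕ) (g : N ⟶ ⨁ (fun _ : Fin k => M)) (h : (⨁ (fun _ : Fin k => M)) ⟶ N),
    g ≫ h = 𝟙 N

/-- A basic module: it has no direct summand of the form `N ⊕ N` with `N ≠ 0`. -/
def IsBasicMod {R : Type} [Ring R] (M : ModCat R) : Prop :=
  ∀ N X : ModCat R, Nonempty (M ≅ (N ⊞ N) ⊞ X) → IsZero N

/-- `M` is τ-rigid, i.e. `Hom(M, τM) = 0`: there is a projective presentation
`P₁ → P₀ → M → 0` by finitely generated projectives such that
`Hom(P₀, M) → Hom(P₁, M)` is surjective (Adachi–Iyama–Reiten). -/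
def IsTauRigidMod {R : Type} [Ring R] (M : ModCat R) : Prop :=
  ∃ (P₁ P₀ : ModCat R) (f : P₁ ⟶ P₀) (g : P₀ ⟶ M),
    Projective P₁ ∧ Projective P₀ ∧ IsFGMod P₁ ∧ IsFGMod P₀ ∧
    Function.Surjective g ∧ Function.Exact f g ∧
    ∀ h : P₁ ⟶ M, ∃ k : P₀ ⟶ M, f ≫ k = h

/-- A τ-rigid pair `(M, P)`: `M` is a τ-rigid module and `P` is a finitely
generated projective with `Hom(P, M) = 0`. -/
def IsTauRigidPairMod {R : Type} [Ring R] (M P : ModCat R) : Prop :=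
  IsFGMod M ∧ IsTauRigidMod M ∧ IsFGMod P ∧ Projective P ∧ ∀ f : P ⟶ M, f = 0

/-- `M` is a support τ-tilting module: `(M, P)` is a maximal τ-rigid pair for
some projective `P` (Adachi–Iyama–Reiten; equivalently, `M` is the `0`-th
cohomology of a two-term silting complex in `K^b(proj)`). -/
def IsSupportTauTiltingMod {R : Type} [Ring R] (M : ModCat R) : Prop :=
  ∃ P : ModCat R, IsTauRigidPairMod M P ∧
    ∀ N Q : ModCat R, IsTauRigidPairMod (M ⊞ N) (P ⊞ Q) → MemAddMod N M ∧ MemAddMod Q P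

/-- The ring `R` admits only finitely many basic support τ-tilting modules up
to isomorphism. -/
def IsTauTiltingFiniteRing (R : Type) [Ring R] : Prop :=
  ∃ (n : ℕ) (f : Fin n → ModCat R),
    ∀ M : ModCat R, IsSupportTauTiltingMod M → IsBasicMod M → ∃ i, Nonempty (M ≅ f i)

/-- The ring `R` admits only finitely many finitely generated indecomposable
modules up to isomorphism. -/
def IsRepFiniteRing (R : Type) [Ring R] : Prop :=
  ∃ (n : ℕ) (f : Fin n → ModCat R),
    ∀ M : ModCat R, IsFGMod M → IsIndecMod M → ∃ i, Nonempty (M ≅ f i)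

/-- `R` has exactly `n` isomorphism classes of basic support τ-tilting modules. -/
def SupportTauTiltingCount (R : Type) [Ring R] (n : ℕ) : Prop :=
  ∃ f : Fin n → ModCat R,
    (∀ i, IsSupportTauTiltingMod (f i) ∧ IsBasicMod (f i)) ∧
    (∀ i j, Nonempty (f i ≅ f j) → i = j) ∧
    (∀ M : ModCat R, IsSupportTauTiltingMod M → IsBasicMod M → ∃ i, Nonempty (M ≅ f i))

/-- An algebra `Λ` is τ-tilting-finite (with respect to right modules,
i.e. left `Λᵐᵒᵖ`-modules). -/
def IsTauTiltingFinite (Λ : Type) [Ring Λ] : Prop := IsTauTiltingFiniteRing Λᵐᵒᵖ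

/-- An algebra `Λ` is representation-finite (with respect to right modules). -/
def IsRepFinite (Λ : Type) [Ring Λ] : Prop := IsRepFiniteRing Λᵐᵒᵖ
/-! ### Radical, idempotents and the (Gabriel) quiver of an algebra. -/

/-- `x` lies in the Jacobson radical (left quasi-regular characterization). -/
def InRad (Λ : Type) [Ring Λ] (x : Λ) : Prop := ∀ y : Λ, IsUnit (1 - y * x)

/-- `x` lies in the square of the Jacobson radical. -/
def InRadSq (Λ : Type) [Ring Λ] (x : Λ) : Prop :=
  x ∈ AddSubgroup.closure {z : Λ | ∃ a b : Λ, InRad Λ a ∧ InRad Λ b ∧ z = a * b}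

/-- The Jacobson radical squares to zero. -/
def RadSqZero (Λ : Type) [Ring Λ] : Prop :=
  ∀ x y : Λ, InRad Λ x → InRad Λ y → x * y = 0

/-- A primitive idempotent. -/
def IsPrimitiveIdem (Λ : Type) [Ring Λ] (f : Λ) : Prop :=
  IsIdempotentElem f ∧ f ≠ 0 ∧
  ∀ a b : Λ, IsIdempotentElem a → IsIdempotentElem b →
    a * b = 0 → b * a = 0 → a + b = f → a = 0 ∨ b = 0

/-- A complete family of pairwise orthogonal primitive idempotents. -/
def IsCompletePrimitiveFamily (Λ : Type) [Ring Λ] {n : ℕ} (e : Fin n → Λ) : Prop :=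
  (∀ i, IsPrimitiveIdem Λ (e i)) ∧ (∀ i j, i ≠ j → e i * e j = 0) ∧ (∑ i, e i) = 1

/-- There is an arrow `i → j` in the Gabriel quiver of `Λ`
(i.e. `e i · (rad Λ / rad² Λ) · e j ≠ 0`). -/
def HasArrow (Λ : Type) [Ring Λ] {n : ℕ} (e : Fin n → Λ) (i j : Fin n) : Prop :=
  ∃ x : Λ, InRad Λ x ∧ ¬ InRadSq Λ (e i * x * e j)

/-- The underlying graph of the Gabriel quiver of `Λ`. -/
def QuiverGraph (Λ : Type) [Ring Λ] {n : ℕ} (e : Fin n → Λ) : SimpleGraph (Fin n) :=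
  SimpleGraph.fromRel (fun i j => HasArrow Λ e i j)

/-- Between any two vertices there is (up to scalars) at most a one-dimensional
space of arrows, i.e. `dim_K (e i · (rad/rad²) · e j) ≤ 1`. -/
def ArrowMultLE1 (Λ : Type) [Ring Λ] (K : Type) [Field K] [Algebra K Λ] {n : ℕ}
    (e : Fin n → Λ) : Prop :=
  ∀ (i j : Fin n) (x y : Λ), InRad Λ x → InRad Λ y →
    ∃ a b : K, (a ≠ 0 ∨ b ≠ 0) ∧ InRadSq Λ (a • (e i * x * e j) + b • (e i * y * e j))

/-- `Λ` is presented by a quiver whose underlying graph is a tree. -/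
def IsTreeQuiverAlgebra (Λ : Type) [Ring Λ] (K : Type) [Field K] [Algebra K Λ] : Prop :=
  ∃ (n : ℕ) (e : Fin n → Λ), IsCompletePrimitiveFamily Λ e ∧
    (∀ i, ¬ HasArrow Λ e i i) ∧
    (∀ i j, ¬ (HasArrow Λ e i j ∧ HasArrow Λ e j i)) ∧
    ArrowMultLE1 Λ K e ∧
    (QuiverGraph Λ e).IsTree
/-! ### The trivial extension `T(Λ) = Λ ⋉ DΛ`. -/

/-- The `K`-linear dual `DΛ = Hom_K(Λ, K)` of the algebra `Λ`, as a
`Λ`-`Λ`-bimodule. -/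
def DualBimodule (K : Type) [Field K] (Λ : Type) [Ring Λ] [Algebra K Λ] : Type :=
  Λ →ₗ[K] K

instance (K : Type) [Field K] (Λ : Type) [Ring Λ] [Algebra K Λ] :
    AddCommGroup (DualBimodule K Λ) :=
  inferInstanceAs (AddCommGroup (Λ →ₗ[K] K))

/-- The left `Λ`-action on `DΛ`: `(a • f) x = f (x * a)`. -/
instance (K : Type) [Field K] (Λ : Type) [Ring Λ] [Algebra K Λ] :
    Module Λ (DualBimodule K Λ) where
  smul a f := (f : Λ →ₗ[K] K).comp (LinearMap.mulRight K a)
  one_smul f := by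
    change Λ →ₗ[K] K at f
    show (f : Λ →ₗ[K] K).comp (LinearMap.mulRight K (1 : Λ)) = f
    ext x; simp
  mul_smul a b f := by
    change Λ →ₗ[K] K at f
    show (f : Λ →ₗ[K] K).comp (LinearMap.mulRight K (a * b)) =
      ((f : Λ →ₗ[K] K).comp (LinearMap.mulRight K b)).comp (LinearMap.mulRight K a)
    ext x; simp [mul_assoc]
  smul_zero a := by
    show (0 : Λ →ₗ[K] K).comp (LinearMap.mulRight K a) = 0
    ext x; simp
  smul_add a f g := by
    show ((f + g : Λ →ₗ[K] K)).comp (LinearMap.mulRight K a) =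
      (f : Λ →ₗ[K] K).comp (LinearMap.mulRight K a) + (g : Λ →ₗ[K] K).comp (LinearMap.mulRight K a)
    ext x; rfl
  add_smul a b f := by
    change Λ →ₗ[K] K at f
    show (f : Λ →ₗ[K] K).comp (LinearMap.mulRight K (a + b)) =
      (f : Λ →ₗ[K] K).comp (LinearMap.mulRight K a) + (f : Λ →ₗ[K] K).comp (LinearMap.mulRight K b)
    ext x; simp [mul_add]
  zero_smul f := by
    change Λ →ₗ[K] K at f
    show (f : Λ →ₗ[K] K).comp (LinearMap.mulRight K (0 : Λ)) = 0
    ext x; simp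

/-- The right `Λ`-action on `DΛ`: `(f • a) x = f (a * x)`. -/
instance (K : Type) [Field K] (Λ : Type) [Ring Λ] [Algebra K Λ] :
    Module Λᵐᵒᵖ (DualBimodule K Λ) where
  smul a f := (f : Λ →ₗ[K] K).comp (LinearMap.mulLeft K a.unop)
  one_smul f := by
    change Λ →ₗ[K] K at f
    show (f : Λ →ₗ[K] K).comp (LinearMap.mulLeft K ((1 : Λᵐᵒᵖ).unop)) = f
    ext x; simp
  mul_smul a b f := by
    change Λ →ₗ[K] K at f
    show (f : Λ →ₗ[K] K).comp (LinearMap.mulLeft K ((a * b).unop)) =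
      ((f : Λ →ₗ[K] K).comp (LinearMap.mulLeft K b.unop)).comp (LinearMap.mulLeft K a.unop)
    ext x; simp [mul_assoc]
  smul_zero a := by
    show (0 : Λ →ₗ[K] K).comp (LinearMap.mulLeft K a.unop) = 0
    ext x; simp
  smul_add a f g := by
    show ((f + g : Λ →ₗ[K] K)).comp (LinearMap.mulLeft K a.unop) =
      (f : Λ →ₗ[K] K).comp (LinearMap.mulLeft K a.unop) + (g : Λ →ₗ[K] K).comp (LinearMap.mulLeft K a.unop)
    ext x; rfl
  add_smul a b f := by
    change Λ →ₗ[K] K at f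
    show (f : Λ →ₗ[K] K).comp (LinearMap.mulLeft K ((a + b).unop)) =
      (f : Λ →ₗ[K] K).comp (LinearMap.mulLeft K a.unop) + (f : Λ →ₗ[K] K).comp (LinearMap.mulLeft K b.unop)
    ext x; simp [add_mul]
  zero_smul f := by
    change Λ →ₗ[K] K at f
    show (f : Λ →ₗ[K] K).comp (LinearMap.mulLeft K ((0 : Λᵐᵒᵖ).unop)) = 0
    ext x; simp

instance (K : Type) [Field K] (Λ : Type) [Ring Λ] [Algebra K Λ] :
    SMulCommClass Λ Λᵐᵒᵖ (DualBimodule K Λ) where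
  smul_comm a b f := by
    change Λ →ₗ[K] K at f
    show ((f : Λ →ₗ[K] K).comp (LinearMap.mulLeft K b.unop)).comp (LinearMap.mulRight K a) =
      ((f : Λ →ₗ[K] K).comp (LinearMap.mulRight K a)).comp (LinearMap.mulLeft K b.unop)
    ext x; simp [mul_assoc]

/-- The trivial extension `T(Λ) = Λ ⋉ DΛ` of the algebra `Λ` by its dual
bimodule; the multiplication is `(a, f) (b, g) = (a b, a g + f b)`. -/
def TrivialExtension (K : Type) [Field K] (Λ : Type) [Ring Λ] [Algebra K Λ] : Type :=
  TrivSqZeroExt Λ (DualBimodule K Λ)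

instance (K : Type) [Field K] (Λ : Type) [Ring Λ] [Algebra K Λ] :
    Ring (TrivialExtension K Λ) :=
  inferInstanceAs (Ring (TrivSqZeroExt Λ (DualBimodule K Λ)))

/-! ### Indecomposable modules and retracts -/

section Indecomposable

variable {L M N U : Type} [AddCommGroup L] [Module R L] [AddCommGroup M] [Module R M]
  [AddCommGroup N] [Module R N] [AddCommGroup U] [Module R U]

/-- `N` is a direct summand of `M`. -/
def ModRetract (R : Type) [Ring R] (N M : Type) [AddCommGroup N] [Module R N] [AddCommGroup M]
    [Module R M] : Prop :=
  ∃ (i : N →ₗ[R] M) (p : M →ₗ[R] N), p ∘ₗ i = LinearMap.id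

/-- `N` is a direct summand of a finite power of `M`. -/
def InAdd (R : Type) [Ring R] (N M : Type) [AddCommGroup N] [Module R N] [AddCommGroup M]
    [Module R M] : Prop :=
  ∃ k : ℕ, ModRetract R N (Fin k → M)

/-- Indecomposability in terms of idempotent endomorphisms. -/
def Indec (R : Type) [Ring R] (M : Type) [AddCommGroup M] [Module R M] : Prop :=
  Nontrivial M ∧ ∀ e : Module.End R M, e * e = e → e = 0 ∨ e = 1

theorem ModRetract.of_equiv (e : N ≃ₗ[R] M) : ModRetract R N M :=
  ⟨e, e.symm, by ext; simp⟩

theorem ModRetract.trans (h : ModRetract R L M) (h' : ModRetract R M N) : ModRetract R L N := by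
  obtain ⟨i, p, h⟩ := h
  obtain ⟨i', p', h'⟩ := h'
  refine ⟨i' ∘ₗ i, p ∘ₗ p', ?_⟩
  ext x
  have h1 := LinearMap.congr_fun h x
  have h2 := LinearMap.congr_fun h' (i x)
  simp only [LinearMap.comp_apply, LinearMap.id_apply] at h1 h2 ⊢
  rw [h2, h1]

theorem ModRetract.finite [Module.Finite R M] (h : ModRetract R N M) : Module.Finite R N := by
  obtain ⟨i, p, h⟩ := h
  exact Module.Finite.of_surjective p fun x => ⟨i x, LinearMap.congr_fun h x⟩

theorem ModRetract.projective [Module.Projective R M] (h : ModRetract R N M) :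
    Module.Projective R N := by
  obtain ⟨i, p, h⟩ := h
  exact Module.Projective.of_split i p h

theorem modRetract_range {e : Module.End R M} (he : e * e = e) :
    ModRetract R (LinearMap.range e) M := by
  refine ⟨Submodule.subtype _, e.rangeRestrict, ?_⟩
  ext ⟨x, y, rfl⟩
  exact LinearMap.congr_fun he y

theorem InAdd.of_retract (h : ModRetract R N M) : InAdd R N M := by
  refine ⟨1, h.trans ⟨LinearMap.pi fun _ => LinearMap.id, LinearMap.proj 0, ?_⟩⟩
  ext; simp

theorem InAdd.finite [Module.Finite R M] (h : InAdd R N M) : Module.Finite R N := by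
  obtain ⟨k, h⟩ := h
  exact h.finite

theorem InAdd.of_sum {ι : Type} [Fintype ι] (i : ι → N →ₗ[R] M) (p : ι → M →ₗ[R] N)
    (h : ∀ x, ∑ j, p j (i j x) = x) : InAdd R N M := by
  let σ := Fintype.equivFin ι
  refine ⟨Fintype.card ι, LinearMap.pi fun j => i (σ.symm j),
    ∑ j, p (σ.symm j) ∘ₗ LinearMap.proj j, ?_⟩
  ext x
  simp only [LinearMap.comp_apply, LinearMap.sum_apply, LinearMap.proj_apply, LinearMap.pi_apply,
    LinearMap.id_apply]
  refine Eq.trans ?_ (h x)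
  exact Equiv.sum_comp σ.symm fun j => p j (i j x)

theorem InAdd.exists_sum (h : InAdd R N M) : ∃ (k : ℕ) (i : Fin k → N →ₗ[R] M)
    (p : Fin k → M →ₗ[R] N), ∀ x, ∑ j, p j (i j x) = x := by
  obtain ⟨k, i, p, h⟩ := h
  refine ⟨k, fun j => LinearMap.proj j ∘ₗ i, fun j => p ∘ₗ LinearMap.single R (fun _ => M) j,
    fun x => ?_⟩
  have := LinearMap.congr_fun h x
  simp only [LinearMap.comp_apply, LinearMap.id_apply] at this
  conv_rhs => rw [← this, ← Finset.univ_sum_single (i x)]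
  simp

theorem InAdd.trans (h : InAdd R L M) (h' : InAdd R M N) : InAdd R L N := by
  obtain ⟨k, i, p, h⟩ := h.exists_sum
  obtain ⟨l, i', p', h'⟩ := h'.exists_sum
  refine InAdd.of_sum (ι := Fin k × Fin l) (fun j => i' j.2 ∘ₗ i j.1)
    (fun j => p j.1 ∘ₗ p' j.2) fun x => ?_
  rw [Fintype.sum_prod_type]
  simp only [LinearMap.comp_apply, ← map_sum, h', h]

theorem InAdd.prod (h : InAdd R L N) (h' : InAdd R M N) : InAdd R (L × M) N := by
  obtain ⟨k, i, p, h⟩ := h.exists_sum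
  obtain ⟨l, i', p', h'⟩ := h'.exists_sum
  refine InAdd.of_sum (ι := Fin k ⊕ Fin l)
    (Sum.elim (fun j => i j ∘ₗ LinearMap.fst R L M) fun j => i' j ∘ₗ LinearMap.snd R L M)
    (Sum.elim (fun j => LinearMap.inl R L M ∘ₗ p j) fun j => LinearMap.inr R L M ∘ₗ p' j)
    fun x => ?_
  rw [Fintype.sum_sum_type]
  simp only [Sum.elim_inl, Sum.elim_inr, LinearMap.comp_apply, ← map_sum, h, h']
  simp

/-- The modules satisfying `p` fall into finitely many isomorphism classes. -/
def FinIso (p : ModuleCat.{0} R → Prop) : Prop :=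
  ∃ l : List (ModuleCat.{0} R), ∀ M, p M → ∃ X ∈ l, Nonempty (M ≃ₗ[R] X)

theorem FinIso.mono {p q : ModuleCat.{0} R → Prop} (h : FinIso q) (hpq : ∀ M, p M → q M) :
    FinIso p := by
  obtain ⟨l, hl⟩ := h
  exact ⟨l, fun M hM => hl M (hpq M hM)⟩

theorem FinIso.or {p q : ModuleCat.{0} R → Prop} (hp : FinIso p) (hq : FinIso q) :
    FinIso fun M => p M ∨ q M := by
  obtain ⟨l, hl⟩ := hp
  obtain ⟨l', hl'⟩ := hq
  refine ⟨l ++ l', fun M hM => ?_⟩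
  rcases hM with hM | hM
  · obtain ⟨X, hX, e⟩ := hl M hM
    exact ⟨X, List.mem_append_left _ hX, e⟩
  · obtain ⟨X, hX, e⟩ := hl' M hM
    exact ⟨X, List.mem_append_right _ hX, e⟩

theorem FinIso.exists_fin {n : ℕ} {p : Fin n → ModuleCat.{0} R → Prop} (h : ∀ i, FinIso (p i)) :
    FinIso fun M => ∃ i, p i M := by
  choose l hl using h
  refine ⟨(List.ofFn l).flatten, ?_⟩
  rintro M ⟨i, hM⟩
  obtain ⟨X, hX, e⟩ := hl i M hM
  exact ⟨X, List.mem_flatten.mpr ⟨l i, List.mem_ofFn.mpr ⟨i, rfl⟩, hX⟩, e⟩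

theorem Indec.equiv_of_retract [Nontrivial N] (h : Indec R M) (hr : ModRetract R N M) :
    Nonempty (N ≃ₗ[R] M) := by
  obtain ⟨i, p, hpi⟩ := hr
  have hpi' : ∀ x, p (i x) = x := fun x => LinearMap.congr_fun hpi x
  rcases h.2 (i ∘ₗ p) (by ext x; simp [hpi']) with h0 | h0
  · obtain ⟨x, hx⟩ := exists_ne (0 : N)
    have := LinearMap.congr_fun h0 (i x)
    simp only [LinearMap.comp_apply, hpi', LinearMap.zero_apply] at this
    exact absurd (by rw [← hpi' x, this, map_zero]) hx
  · exact ⟨LinearEquiv.ofLinearMap i p h0 hpi⟩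

variable [IsArtinianRing R]

theorem Indec.isNilpotent_or_isUnit [Module.Finite R M] (h : Indec R M) (f : Module.End R M) :
    IsNilpotent f ∨ IsUnit f := by
  obtain ⟨k, hk⟩ := Filter.eventually_atTop.mp f.eventually_isCompl_ker_pow_range_pow
  have hc := hk (k + 1) (by omega)
  rcases h.2 _ (Submodule.isIdempotentElem_projection hc) with h0 | h0
  · right
    have hker : LinearMap.ker (f ^ (k + 1)) = ⊥ := by
      rw [← Submodule.range_projection hc, h0, LinearMap.range_zero]
    have hrange : LinearMap.range (f ^ (k + 1)) = ⊤ := by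
      rw [← Submodule.ker_projection hc, h0, LinearMap.ker_zero]
    have : IsUnit (f ^ (k + 1)) := (Module.End.isUnit_iff _).mpr
      ⟨LinearMap.ker_eq_bot.mp hker, LinearMap.range_eq_top.mp hrange⟩
    exact (isUnit_pow_iff (by omega)).mp this
  · left
    refine ⟨k + 1, ?_⟩
    rw [← LinearMap.ker_eq_top, ← Submodule.range_projection hc, h0]
    exact LinearMap.range_eq_top.mpr Function.surjective_id

theorem Indec.isLocalRing [Module.Finite R M] (h : Indec R M) : IsLocalRing (Module.End R M) := by
  have := h.1
  refine IsLocalRing.of_isUnit_or_isUnit_one_sub_self fun f => ?_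
  rcases h.isNilpotent_or_isUnit f with hf | hf
  · exact Or.inr hf.isUnit_one_sub
  · exact Or.inl hf

/-- If the identity of an indecomposable module is a sum of endomorphisms factoring through `M`,
then one of the summands is invertible. -/
theorem Indec.retract_of_sum {ι : Type} [Fintype ι] [Module.Finite R U] (h : Indec R U)
    {M : ι → Type} [∀ j, AddCommGroup (M j)] [∀ j, Module R (M j)]
    (i : ∀ j, U →ₗ[R] M j) (p : ∀ j, M j →ₗ[R] U) (hs : ∀ x, ∑ j, p j (i j x) = x) :
    ∃ j, ModRetract R U (M j) := by
  have := h.isLocalRing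
  have : IsUnit (∑ j, (p j ∘ₗ i j : Module.End R U)) := by
    have : (∑ j, (p j ∘ₗ i j : Module.End R U)) = 1 := by
      ext x; simp [LinearMap.sum_apply, hs]
    rw [this]
    exact isUnit_one
  obtain ⟨j, -, u, hu⟩ := IsLocalRing.exists_of_isUnit_sum this
  refine ⟨j, i j, (↑u⁻¹ : Module.End R U) ∘ₗ p j, ?_⟩
  rw [LinearMap.comp_assoc, ← hu]
  exact u.inv_mul

theorem Indec.retract_of_inAdd [Module.Finite R U] (h : Indec R U) (ha : InAdd R U M) :
    ModRetract R U M := by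
  obtain ⟨k, i, p, hs⟩ := ha.exists_sum
  obtain ⟨-, h⟩ := h.retract_of_sum (M := fun _ => M) i p hs
  exact h

theorem Indec.retract_of_idempotent [Module.Finite R U] (h : Indec R U) {e : Module.End R M}
    (hr : ModRetract R U M) :
    ModRetract R U (LinearMap.range e) ∨ ModRetract R U (LinearMap.range (1 - e)) := by
  obtain ⟨i, p, hpi⟩ := hr
  obtain ⟨j, hj⟩ := h.retract_of_sum
    (M := fun b : Bool => LinearMap.range (cond b e (1 - e)))
    (fun b => (cond b e (1 - e)).rangeRestrict ∘ₗ i)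
    (fun b => p ∘ₗ Submodule.subtype _) (fun x => by
      have := LinearMap.congr_fun hpi x
      simp only [LinearMap.comp_apply, LinearMap.id_apply] at this
      simp [this])
  cases j
  · exact Or.inr hj
  · exact Or.inl hj

variable (N) in
theorem finIso_indec_retract [Module.Finite R N] :
    FinIso fun U : ModuleCat.{0} R => Indec R U ∧ ModRetract R U N := by
  have key : ∀ A : Submodule R N, FinIso fun U : ModuleCat.{0} R =>
      Indec R U ∧ ModRetract R U A := by
    intro A
    induction A using WellFoundedLT.induction with
    | ind A ih =>
    by_cases hA : Indec R A
    · refine ⟨[ModuleCat.of R A], fun U hU => ⟨_, List.mem_singleton_self _, ?_⟩⟩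
      have := hU.1.1
      exact hA.equiv_of_retract hU.2
    by_cases hn : Nontrivial A
    · obtain ⟨e, he, he0, he1⟩ : ∃ e : Module.End R A, e * e = e ∧ e ≠ 0 ∧ e ≠ 1 := by
        by_contra hcon
        push Not at hcon
        exact hA ⟨hn, fun e he => or_iff_not_imp_left.mpr (hcon e he)⟩
      have hlt : ∀ f : Module.End R A, f * f = f → f ≠ 1 →
          (LinearMap.range f).map A.subtype < A := by
        intro f hf hf1
        refine lt_of_le_of_ne (Submodule.map_subtype_le _ _) fun heq => hf1 ?_
        have : LinearMap.range f = ⊤ := by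
          apply Submodule.map_injective_of_injective A.injective_subtype
          rw [heq, Submodule.map_subtype_top]
        ext x
        obtain ⟨y, rfl⟩ := LinearMap.range_eq_top.mp this x
        exact congrArg Subtype.val (LinearMap.congr_fun hf y)
      have he' : (1 - e) * (1 - e) = 1 - e := by
        rw [mul_sub, sub_mul, sub_mul, he]; simp
      have h1 := ih _ (hlt e he he1)
      have h2 := ih _ (hlt (1 - e) he' (by simpa using he0))
      refine (h1.or h2).mono fun U hU => ?_
      have := hU.2.finite
      have eqv : ∀ f : Module.End R A, LinearMap.range f ≃ₗ[R] (LinearMap.range f).map A.subtype :=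
        fun f => Submodule.equivMapOfInjective _ A.injective_subtype _
      rcases hU.1.retract_of_idempotent (e := e) hU.2 with h | h
      · exact Or.inl ⟨hU.1, h.trans (.of_equiv (eqv _))⟩
      · exact Or.inr ⟨hU.1, h.trans (.of_equiv (eqv _))⟩
    · refine ⟨[], fun U hU => absurd ?_ hn⟩
      obtain ⟨hU, i, p, hpi⟩ := hU
      have := hU.1
      have : Function.Injective i := Function.LeftInverse.injective (LinearMap.congr_fun hpi)
      exact this.nontrivial
  exact (key ⊤).mono fun U hU => ⟨hU.1, hU.2.trans (.of_equiv Submodule.topEquiv.symm)⟩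

end Indecomposable

/-! ### The radical and projective covers -/

section Radical

variable {M N P : Type} [AddCommGroup M] [Module R M] [AddCommGroup N] [Module R N]
  [AddCommGroup P] [Module R P]

/-- The radical `J M` of a module `M`, where `J` is the Jacobson radical of the ring. -/
def radMod (R : Type) [Ring R] (M : Type) [AddCommGroup M] [Module R M] : Submodule R M :=
  Ring.jacobson R • (⊤ : Submodule R M)

theorem smul_mem_radMod {x : R} (hx : x ∈ Ring.jacobson R) (m : M) : x • m ∈ radMod R M :=
  Submodule.smul_mem_smul hx trivial

theorem radMod_le {W : Submodule R M} :
    radMod R M ≤ W ↔ ∀ x ∈ Ring.jacobson R, ∀ m : M, x • m ∈ W := by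
  rw [radMod, Submodule.smul_le]
  exact ⟨fun h x hx m => h x hx m trivial, fun h x hx m _ => h x hx m⟩

theorem map_mem_radMod (f : M →ₗ[R] N) {m : M} (hm : m ∈ radMod R M) : f m ∈ radMod R N := by
  have : radMod R M ≤ (radMod R N).comap f := radMod_le.mpr fun x hx m => by
    rw [Submodule.mem_comap, map_smul]
    exact smul_mem_radMod hx _
  exact this hm

/-- Nakayama's lemma. -/
theorem eq_top_of_sup_radMod [Module.Finite R M] {W : Submodule R M} (h : W ⊔ radMod R M = ⊤) :
    W = ⊤ := by
  by_contra hW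
  obtain ⟨C, hC, hWC⟩ := (eq_top_or_exists_le_coatom W).resolve_left hW
  have h1 : radMod R M ≤ C := (Ring.jacobson_smul_top_le R M).trans (sInf_le hC)
  exact hC.1 (top_le_iff.mp (h ▸ sup_le hWC h1))

theorem surjective_of_range_sup_radMod [Module.Finite R N] {f : M →ₗ[R] N}
    (h : LinearMap.range f ⊔ radMod R N = ⊤) : Function.Surjective f :=
  LinearMap.range_eq_top.mp (eq_top_of_sup_radMod h)

theorem subsingleton_of_radMod_eq_top [Module.Finite R M] (h : radMod R M = ⊤) :
    Subsingleton M := by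
  have : (⊥ : Submodule R M) = ⊤ := eq_top_of_sup_radMod (by rw [bot_sup_eq, h])
  exact (Submodule.subsingleton_iff R).mp (subsingleton_iff_bot_eq_top.mp this)

variable [IsArtinianRing R]

theorem isSemisimpleModule_of_radMod_eq_bot (h : radMod R M = ⊥) : IsSemisimpleModule R M := by
  have hJ : Module.IsTorsionBySet R M (Ring.jacobson R) := fun m x =>
    (Submodule.mem_bot R).mp (h ▸ smul_mem_radMod x.2 m)
  let _ := hJ.module
  exact (hJ.semilinearMap.isSemisimpleModule_iff_of_bijective Function.bijective_id).2
    inferInstance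

/-- Above the radical, the submodule lattice is complemented. -/
theorem exists_complement_above {U W : Submodule R M} (hU : radMod R M ≤ U) (hW : U ≤ W) :
    ∃ A, U ≤ A ∧ A ⊔ W = ⊤ ∧ A ⊓ W = U := by
  have : IsSemisimpleModule R (M ⧸ U) := by
    refine isSemisimpleModule_of_radMod_eq_bot (le_bot_iff.mp (radMod_le.mpr fun x hx m => ?_))
    obtain ⟨m, rfl⟩ := U.mkQ_surjective m
    rw [← map_smul, Submodule.mem_bot, Submodule.mkQ_apply, Submodule.Quotient.mk_eq_zero]
    exact hU (smul_mem_radMod hx m)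
  obtain ⟨B, hB⟩ := exists_isCompl (W.map U.mkQ)
  refine ⟨B.comap U.mkQ, U.le_comap_mkQ B, ?_, ?_⟩
  · apply top_le_iff.mp
    intro m _
    have : U.mkQ m ∈ W.map U.mkQ ⊔ B := hB.sup_eq_top ▸ trivial
    obtain ⟨_, ⟨y, hy, rfl⟩, z, hz, hyz⟩ := Submodule.mem_sup.mp this
    refine Submodule.mem_sup.mpr ⟨m - y, ?_, y, hy, by simp⟩
    rw [Submodule.mem_comap, map_sub, ← hyz]
    simpa using hz
  · refine le_antisymm (fun m hm => ?_) (le_inf (U.le_comap_mkQ B) hW)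
    have : U.mkQ m ∈ W.map U.mkQ ⊓ B := ⟨⟨m, hm.2, rfl⟩, hm.1⟩
    rw [hB.inf_eq_bot, Submodule.mem_bot] at this
    simpa using this

theorem exists_power_surjection (R : Type) [Ring R] (M : Type) [AddCommGroup M] [Module R M]
    [Module.Finite R M] : ∃ (m : ℕ) (f : (Fin m → R) →ₗ[R] M), Function.Surjective f :=
  Module.Finite.exists_fin' R M

theorem exists_pow_isCompl [Module.Finite R M] (f : Module.End R M) :
    ∃ k : ℕ, 0 < k ∧ IsCompl (LinearMap.ker (f ^ k)) (LinearMap.range (f ^ k)) := by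
  obtain ⟨k, hk⟩ := Filter.eventually_atTop.mp f.eventually_isCompl_ker_pow_range_pow
  exact ⟨k + 1, by omega, hk _ (by omega)⟩

/-- Every finitely generated module over an artinian ring has a projective cover. -/
theorem exists_cover (N : Type) [AddCommGroup N] [Module R N] [Module.Finite R N] :
    ∃ (P : Type) (_ : AddCommGroup P) (_ : Module R P) (p : P →ₗ[R] N),
      Module.Finite R P ∧ Module.Projective R P ∧ Function.Surjective p ∧
        LinearMap.ker p ≤ radMod R P := by
  obtain ⟨m, π, hπ⟩ := exists_power_surjection R N
  let S : Set (Submodule R (Fin m → R)) :=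
    {Q | Module.Projective R Q ∧ Function.Surjective (π.domRestrict Q)}
  obtain ⟨P, ⟨hP, hs⟩, hmin⟩ := WellFounded.has_min (r := (· < · : _ → _ → Prop)) wellFounded_lt S
    ⟨⊤, Module.Projective.of_equiv Submodule.topEquiv.symm, fun x => by
      obtain ⟨y, rfl⟩ := hπ x; exact ⟨⟨y, trivial⟩, rfl⟩⟩
  refine ⟨P, inferInstance, inferInstance, π.domRestrict P, inferInstance, hP, hs, ?_⟩
  set p := π.domRestrict P with hp
  by_contra hK
  obtain ⟨A, hUA, hsup, hinf⟩ := exists_complement_above (U := radMod R P)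
    (W := LinearMap.ker p ⊔ radMod R P) le_rfl le_sup_right
  have hA : A ≠ ⊤ := by
    rintro rfl
    rw [top_inf_eq] at hinf
    exact hK (hinf ▸ le_sup_left)
  have hAK : A ⊔ LinearMap.ker p = ⊤ := by
    rw [← hsup, sup_comm (LinearMap.ker p), ← sup_assoc, sup_eq_left.mpr hUA]
  have hpA : Function.Surjective (p ∘ₗ A.subtype) := by
    intro x
    obtain ⟨y, rfl⟩ := hs x
    obtain ⟨a, ha, k, hk, rfl⟩ := Submodule.mem_sup.mp (hAK ▸ trivial : y ∈ A ⊔ LinearMap.ker p)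
    refine ⟨⟨a, ha⟩, ?_⟩
    rw [map_add, LinearMap.mem_ker.mp hk, add_zero]
    rfl
  obtain ⟨φ, hφ⟩ := Module.projective_lifting_property (p ∘ₗ A.subtype) p hpA
  let ψ : Module.End R P := A.subtype ∘ₗ φ
  obtain ⟨k, hk, hc⟩ := exists_pow_isCompl ψ
  have hpk : ∀ n : ℕ, ∀ x, p ((ψ ^ n) x) = p x := by
    intro n
    induction n with
    | zero => intro x; rfl
    | succ n ih =>
      intro x
      rw [pow_succ', Module.End.mul_apply]
      exact (LinearMap.congr_fun hφ _).trans (ih x)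
  have hle : LinearMap.range (ψ ^ k) ≤ A := by
    rintro _ ⟨x, rfl⟩
    obtain ⟨k, rfl⟩ := Nat.exists_eq_succ_of_ne_zero hk.ne'
    rw [pow_succ', Module.End.mul_apply]
    exact (φ _).2
  refine hmin ((LinearMap.range (ψ ^ k)).map P.subtype) ⟨?_, ?_⟩ ?_
  · have : ModRetract R (LinearMap.range (ψ ^ k)) P :=
      ⟨Submodule.subtype _, Submodule.projectionOnto _ _ hc.symm,
        Submodule.projectionOnto_comp_subtype _⟩
    have := this.projective
    exact Module.Projective.of_equiv
      (Submodule.equivMapOfInjective _ P.injective_subtype (LinearMap.range (ψ ^ k)))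
  · intro x
    obtain ⟨y, rfl⟩ := hs x
    exact ⟨⟨_, Submodule.mem_map_of_mem (LinearMap.mem_range_self (ψ ^ k) y)⟩, hpk k y⟩
  · refine lt_of_le_of_ne (Submodule.map_subtype_le _ _) fun heq => hA (top_le_iff.mp ?_)
    refine le_trans (le_of_eq ?_) hle
    apply Submodule.map_injective_of_injective P.injective_subtype
    rw [heq, Submodule.map_subtype_top]

end Radical

/-! ### Presentations and τ-rigidity -/

section Presentations

variable {L M N P P' Q U X Y : Type} [AddCommGroup L] [Module R L] [AddCommGroup M] [Module R M]
  [AddCommGroup N] [Module R N] [AddCommGroup P] [Module R P] [AddCommGroup P'] [Module R P']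
  [AddCommGroup Q] [Module R Q] [AddCommGroup U]
  [Module R U] [AddCommGroup X] [Module R X] [AddCommGroup Y] [Module R Y]

theorem exists_descend {g : M →ₗ[R] N} (hg : Function.Surjective g) (k : M →ₗ[R] X)
    (h : ∀ x, g x = 0 → k x = 0) : ∃ v : N →ₗ[R] X, ∀ x, v (g x) = k x := by
  refine ⟨(LinearMap.ker g).liftQ k h ∘ₗ (g.quotKerEquivOfSurjective hg).symm, fun x => ?_⟩
  have : (g.quotKerEquivOfSurjective hg).symm (g x) = (LinearMap.ker g).mkQ x := by
    rw [LinearEquiv.symm_apply_eq]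
    rfl
  rw [LinearMap.comp_apply, LinearEquiv.coe_coe, this]
  rfl

theorem exists_lift [Module.Projective R P] (f : M →ₗ[R] N) (h : P →ₗ[R] N)
    (hr : ∀ x, ∃ y, f y = h x) : ∃ k : P →ₗ[R] M, ∀ x, f (k x) = h x := by
  obtain ⟨k, hk⟩ := Module.projective_lifting_property f.rangeRestrict
    (h.codRestrict (LinearMap.range f) hr) f.surjective_rangeRestrict
  exact ⟨k, fun x => congrArg Subtype.val (LinearMap.congr_fun hk x)⟩

/-- Every homomorphism from the source of `f` to `X` extends along `f`. -/
def InT (f : P →ₗ[R] Q) (X : Type) [AddCommGroup X] [Module R X] : Prop :=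
  ∀ h : P →ₗ[R] X, ∃ k : Q →ₗ[R] X, ∀ x, k (f x) = h x

theorem InT.of_surjective [Module.Projective R P] {f : P →ₗ[R] Q} (hX : InT f X) (s : X →ₗ[R] Y)
    (hs : Function.Surjective s) : InT f Y := by
  intro h
  obtain ⟨h', hh'⟩ := exists_lift s h fun x => hs _
  obtain ⟨k, hk⟩ := hX h'
  exact ⟨s ∘ₗ k, fun x => by rw [LinearMap.comp_apply, hk, hh']⟩

theorem InT.pi {f : P →ₗ[R] Q} (hX : InT f X) (k : ℕ) : InT f (Fin k → X) := by
  intro h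
  choose l hl using fun j => hX (LinearMap.proj j ∘ₗ h)
  exact ⟨LinearMap.pi l, fun x => funext fun j => hl j x⟩

theorem InT.prod {f : P →ₗ[R] Q} (hX : InT f X) (hY : InT f Y) : InT f (X × Y) := by
  intro h
  obtain ⟨k, hk⟩ := hX (LinearMap.fst R X Y ∘ₗ h)
  obtain ⟨l, hl⟩ := hY (LinearMap.snd R X Y ∘ₗ h)
  exact ⟨k.prod l, fun x => Prod.ext (hk x) (hl x)⟩

theorem InT.of_inAdd [Module.Projective R P] {f : P →ₗ[R] Q} (hX : InT f X) (h : InAdd R Y X) :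
    InT f Y := by
  obtain ⟨k, i, p, hip⟩ := h
  exact (hX.pi k).of_surjective p fun x => ⟨i x, LinearMap.congr_fun hip x⟩

/-- A projective presentation of the module `M`. -/
structure Pres (R : Type) [Ring R] (M : Type) [AddCommGroup M] [Module R M] where
  P₁ : ModuleCat.{0} R
  P₀ : ModuleCat.{0} R
  f : P₁ →ₗ[R] P₀
  g : P₀ →ₗ[R] M
  fin₁ : Module.Finite R P₁
  fin₀ : Module.Finite R P₀
  proj₁ : Module.Projective R P₁
  proj₀ : Module.Projective R P₀
  surj : Function.Surjective g
  exact : Function.Exact f g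

attribute [instance] Pres.fin₁ Pres.fin₀ Pres.proj₁ Pres.proj₀

variable (R M) in
/-- τ-rigidity of `M`. -/
def TauRigid : Prop := ∃ p : Pres R M, InT p.f M

theorem Pres.g_f (p : Pres R M) (x : p.P₁) : p.g (p.f x) = 0 := p.exact.apply_apply_eq_zero x

/-- The direct sum of two presentations. -/
def Pres.prod (p : Pres R M) (q : Pres R N) : Pres R (M × N) where
  P₁ := ModuleCat.of R (p.P₁ × q.P₁)
  P₀ := ModuleCat.of R (p.P₀ × q.P₀)
  f := p.f.prodMap q.f
  g := p.g.prodMap q.g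
  fin₁ := inferInstanceAs (Module.Finite R (p.P₁ × q.P₁))
  fin₀ := inferInstanceAs (Module.Finite R (p.P₀ × q.P₀))
  proj₁ := inferInstanceAs (Module.Projective R (p.P₁ × q.P₁))
  proj₀ := inferInstanceAs (Module.Projective R (p.P₀ × q.P₀))
  surj := Function.Surjective.prodMap p.surj q.surj
  exact := fun y => by
    constructor
    · intro h
      obtain ⟨x, hx⟩ := (p.exact y.1).mp (congrArg Prod.fst h)
      obtain ⟨z, hz⟩ := (q.exact y.2).mp (congrArg Prod.snd h)
      exact ⟨(x, z), Prod.ext hx hz⟩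
    · rintro ⟨x, rfl⟩
      exact Prod.ext (p.g_f x.1) (q.g_f x.2)

theorem InT.prodMap {f : P →ₗ[R] Q} {f' : M →ₗ[R] N} (hX : InT f X) (hX' : InT f' X) :
    InT (f.prodMap f') X := by
  intro h
  obtain ⟨k, hk⟩ := hX (h ∘ₗ LinearMap.inl R P M)
  obtain ⟨l, hl⟩ := hX' (h ∘ₗ LinearMap.inr R P M)
  refine ⟨k.coprod l, fun x => ?_⟩
  simp only [LinearMap.coprod_apply, LinearMap.prodMap_apply, hk, hl, LinearMap.comp_apply]
  rw [← map_add]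
  simp

theorem InT.presProd {p : Pres R M} {q : Pres R N} (hp : InT p.f X) (hq : InT q.f X) :
    InT (p.prod q).f X :=
  InT.prodMap hp hq

instance projective_pi (k : ℕ) [Module.Projective R P] : Module.Projective R (Fin k → P) :=
  Module.Projective.of_equiv (DFinsupp.linearEquivFunOnFintype (R := R) (M := fun _ : Fin k => P))

/-- The `k`-th power of a homomorphism. -/
def powMap (k : ℕ) (f : M →ₗ[R] N) : (Fin k → M) →ₗ[R] (Fin k → N) :=
  LinearMap.pi fun j => f ∘ₗ LinearMap.proj j

@[simp] theorem powMap_apply (k : ℕ) (f : M →ₗ[R] N) (x : Fin k → M) (j : Fin k) :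
    powMap k f x j = f (x j) := rfl

/-- The direct sum of `k` copies of a presentation. -/
def Pres.pi (k : ℕ) (p : Pres R M) : Pres R (Fin k → M) where
  P₁ := ModuleCat.of R (Fin k → p.P₁)
  P₀ := ModuleCat.of R (Fin k → p.P₀)
  f := powMap k p.f
  g := powMap k p.g
  fin₁ := inferInstanceAs (Module.Finite R (Fin k → p.P₁))
  fin₀ := inferInstanceAs (Module.Finite R (Fin k → p.P₀))
  proj₁ := inferInstanceAs (Module.Projective R (Fin k → p.P₁))
  proj₀ := inferInstanceAs (Module.Projective R (Fin k → p.P₀))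
  surj := fun y => by
    choose x hx using fun j => p.surj (y j)
    exact ⟨x, funext hx⟩
  exact := fun y => by
    constructor
    · intro h
      choose x hx using fun j => (p.exact (y j)).mp (congrFun h j)
      exact ⟨x, funext hx⟩
    · rintro ⟨x, rfl⟩
      exact funext fun j => p.g_f (x j)

theorem exists_extend_powMap {f : P →ₗ[R] Q} (hX : InT f X) (k : ℕ) (h : (Fin k → P) →ₗ[R] X) :
    ∃ l : (Fin k → Q) →ₗ[R] X, ∀ x, l (powMap k f x) = h x := by
  choose l hl using fun j => hX (h ∘ₗ LinearMap.single R (fun _ => P) j)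
  refine ⟨∑ j, l j ∘ₗ LinearMap.proj j, fun x => ?_⟩
  simp only [LinearMap.sum_apply, LinearMap.comp_apply, LinearMap.proj_apply, powMap_apply, hl,
    LinearMap.single_apply, ← map_sum]
  rw [Finset.univ_sum_single]

/-- Vanishing of `Ext` in the sense of `InT` for some presentation passes to minimal presentations
of summands. -/
theorem InT.of_retract [IsArtinianRing R] {p : Pres R U} (hp : LinearMap.ker p.f ≤ radMod R p.P₁)
    {q : Pres R M} (hr : ModRetract R U M) (hX : InT q.f X) : InT p.f X := by
  obtain ⟨i, π, hπi⟩ := hr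
  obtain ⟨φ₀, hφ₀⟩ := exists_lift q.g (i ∘ₗ p.g) fun x => q.surj _
  obtain ⟨ψ₀, hψ₀⟩ := exists_lift p.g (π ∘ₗ q.g) fun x => p.surj _
  obtain ⟨φ₁, hφ₁⟩ := exists_lift q.f (φ₀ ∘ₗ p.f) fun x => (q.exact _).mp (by
    rw [LinearMap.comp_apply, hφ₀, LinearMap.comp_apply, p.g_f, map_zero])
  obtain ⟨ψ₁, hψ₁⟩ := exists_lift p.f (ψ₀ ∘ₗ q.f) fun x => (p.exact _).mp (by
    rw [LinearMap.comp_apply, hψ₀, LinearMap.comp_apply, q.g_f, map_zero])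
  have hid : ∀ x, π (i x) = x := LinearMap.congr_fun hπi
  obtain ⟨s, hs⟩ := exists_lift p.f (ψ₀ ∘ₗ φ₀ - LinearMap.id) fun x => (p.exact _).mp (by
    simp only [LinearMap.sub_apply, LinearMap.comp_apply, LinearMap.id_apply, map_sub, hψ₀, hφ₀,
      hid, sub_self])
  simp only [LinearMap.comp_apply, LinearMap.sub_apply, LinearMap.id_apply] at hφ₁ hψ₁ hs
  let u : p.P₁ →ₗ[R] p.P₁ := ψ₁ ∘ₗ φ₁ - s ∘ₗ p.f
  have hu : ∀ x, x - u x ∈ radMod R p.P₁ := fun x => hp (by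
    simp only [u, LinearMap.mem_ker, map_sub, LinearMap.sub_apply, LinearMap.comp_apply, hψ₁, hφ₁,
      hs]
    abel)
  have hsurj : Function.Surjective u := surjective_of_range_sup_radMod (by
    refine top_le_iff.mp fun x _ => ?_
    rw [← add_sub_cancel (u x) x]
    exact Submodule.add_mem_sup ⟨x, rfl⟩ (hu x))
  have hinj : Function.Injective u := IsNoetherian.injective_of_surjective_endomorphism u hsurj
  let e := LinearEquiv.ofBijective u ⟨hinj, hsurj⟩
  intro h
  obtain ⟨k, hk⟩ := hX (h ∘ₗ e.symm ∘ₗ ψ₁)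
  refine ⟨k ∘ₗ φ₀ - h ∘ₗ e.symm ∘ₗ s, fun x => ?_⟩
  have hx : e.symm (ψ₁ (φ₁ x)) - e.symm (s (p.f x)) = x := by
    rw [← map_sub]
    exact e.symm_apply_apply x
  simp only [LinearMap.sub_apply, LinearMap.comp_apply, ← hφ₁, hk, LinearEquiv.coe_coe]
  rw [← map_sub, hx]

theorem InT.of_inAdd_left [IsArtinianRing R] {p : Pres R U}
    (hp : LinearMap.ker p.f ≤ radMod R p.P₁)
    {q : Pres R M} (hr : InAdd R U M) (hX : InT q.f X) : InT p.f X := by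
  obtain ⟨k, hr⟩ := hr
  exact InT.of_retract (q := q.pi k) hp hr fun h => exists_extend_powMap hX k h

theorem exists_minPres [IsArtinianRing R] [Module.Finite R M] :
    ∃ p : Pres R M, LinearMap.ker p.f ≤ radMod R p.P₁ := by
  obtain ⟨P₀, _, _, g, _, _, hg, -⟩ := exists_cover (R := R) M
  obtain ⟨P₁, _, _, f, _, _, hf, hk⟩ := exists_cover (R := R) (LinearMap.ker g)
  refine ⟨⟨.of R P₁, .of R P₀, (LinearMap.ker g).subtype ∘ₗ f, g, ‹_›, ‹_›, ‹_›, ‹_›, hg,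
    fun y => ⟨fun hy => ?_, ?_⟩⟩, fun x hx => hk ?_⟩
  · obtain ⟨x, hx⟩ := hf ⟨y, hy⟩
    exact ⟨x, congrArg Subtype.val hx⟩
  · rintro ⟨x, rfl⟩
    exact (f x).2
  · exact Subtype.ext hx

theorem TauRigid.of_inAdd [IsArtinianRing R] [Module.Finite R M] (h : TauRigid R M)
    (hr : InAdd R U M) : TauRigid R U := by
  have := hr.finite
  obtain ⟨q, hq⟩ := h
  obtain ⟨p, hp⟩ := exists_minPres (R := R) (M := U)
  exact ⟨p, InT.of_inAdd_left hp hr (hq.of_inAdd hr)⟩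

end Presentations

/-! ### Bongartz completion -/

section Bongartz

variable {M N U X : Type} [AddCommGroup M] [Module R M]
  [AddCommGroup N] [Module R N] [AddCommGroup U] [Module R U] [AddCommGroup X] [Module R X]

theorem exists_hom_generators (K : Type) [Field K] [Algebra K R] [FiniteDimensional K R]
    (M N : Type) [AddCommGroup M] [Module R M] [AddCommGroup N] [Module R N]
    [Module.Finite R M] [Module.Finite R N] :
    ∃ (r : ℕ) (g : Fin r → M →ₗ[R] N), ∀ h : M →ₗ[R] N, ∃ c : Fin r → K,
      ∀ x, h x = ∑ i, algebraMap K R (c i) • g i x := by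
  let _ : Module K N := Module.compHom N (algebraMap K R)
  have : IsScalarTower K R N := ⟨fun k r n => by
    rw [Algebra.smul_def, mul_smul]; rfl⟩
  have : SMulCommClass R K N := ⟨fun r k n => by
    change r • algebraMap K R k • n = algebraMap K R k • r • n
    rw [← mul_smul, ← mul_smul, Algebra.commutes]⟩
  have : Module.Finite K N := Module.Finite.trans R N
  obtain ⟨m, π, hπ⟩ := exists_power_surjection R M
  let ev : (M →ₗ[R] N) →ₗ[K] (Fin m → N) :=
    { toFun := fun h j => h (π (Pi.single j 1))
      map_add' := fun _ _ => rfl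
      map_smul' := fun _ _ => rfl }
  have hev : Function.Injective ev := by
    intro h h' hh
    have : h ∘ₗ π = h' ∘ₗ π := LinearMap.pi_ext' fun j => LinearMap.ext_ring (congrFun hh j)
    ext x
    obtain ⟨y, rfl⟩ := hπ x
    exact LinearMap.congr_fun this y
  have : Module.Finite K (M →ₗ[R] N) := Module.Finite.of_injective ev hev
  obtain ⟨r, g, hg⟩ := Module.Finite.exists_fin (R := K) (M := M →ₗ[R] N)
  refine ⟨r, g, fun h => ?_⟩
  obtain ⟨c, hc⟩ :=
    (Submodule.mem_span_range_iff_exists_fun K).mp (hg ▸ Submodule.mem_top : h ∈ Submodule.span K (Set.range g))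
  refine ⟨c, fun x => ?_⟩
  rw [← hc, LinearMap.sum_apply]
  rfl

/-- Multiplication by a scalar as an endomorphism. -/
def scalarEnd {K : Type} [Field K] [Algebra K R] (M : Type) [AddCommGroup M] [Module R M] (c : K) :
    M →ₗ[R] M where
  toFun x := algebraMap K R c • x
  map_add' := smul_add _
  map_smul' a x := by rw [RingHom.id_apply, ← mul_smul, ← mul_smul, Algebra.commutes]

theorem exists_bongartz (K : Type) [Field K] [Algebra K R] [FiniteDimensional K R]
    (p : Pres R U) (hp : LinearMap.ker p.f ≤ radMod R p.P₁) (hU : InT p.f U) :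
    ∃ (E : ModuleCat.{0} R) (q : Pres R E), Module.Finite R E ∧ InT p.f E ∧
      (∀ (X : Type) [AddCommGroup X] [Module R X] [Module.Finite R X], InT p.f X →
        ∃ (m : ℕ) (s : (Fin m → E) →ₗ[R] X), Function.Surjective s) ∧
      (∀ (X : Type) [AddCommGroup X] [Module R X], InT p.f X → InT q.f X) ∧
      (∀ (Q : Type) [AddCommGroup Q] [Module R Q] [Module.Finite R Q] [Module.Projective R Q],
        (∀ h : Q →ₗ[R] E, h = 0) → Subsingleton Q) := by
  obtain ⟨r, g, hg⟩ := exists_hom_generators (R := R) K p.P₁ R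
  let F : (Fin r → p.P₁) →ₗ[R] (Fin r → p.P₀) × R :=
    (powMap r p.f).prod (∑ i, g i ∘ₗ LinearMap.proj i)
  have hF : ∀ x, F x = (powMap r p.f x, ∑ i, g i (x i)) := fun x => by simp [F]
  let D := LinearMap.range F
  let E := ((Fin r → p.P₀) × R) ⧸ D
  have hmk : ∀ x, D.mkQ x = 0 ↔ ∃ y, F y = x := fun x => by
    rw [Submodule.mkQ_apply, Submodule.Quotient.mk_eq_zero, LinearMap.mem_range]
  let q : Pres R E := ⟨.of R (Fin r → p.P₁), .of R ((Fin r → p.P₀) × R), F, D.mkQ,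
    inferInstanceAs (Module.Finite R (Fin r → p.P₁)),
    inferInstanceAs (Module.Finite R ((Fin r → p.P₀) × R)),
    inferInstanceAs (Module.Projective R (Fin r → p.P₁)),
    inferInstanceAs (Module.Projective R ((Fin r → p.P₀) × R)),
    D.mkQ_surjective, hmk⟩
  refine ⟨.of R E, q, inferInstanceAs (Module.Finite R (((Fin r → p.P₀) × R) ⧸ D)), ?_, ?_, ?_, ?_⟩
  · intro (h : p.P₁ →ₗ[R] E)
    obtain ⟨h', hh'⟩ := exists_lift D.mkQ h fun x => D.mkQ_surjective _
    obtain ⟨k, hk⟩ := hU.pi r (powMap r p.g ∘ₗ LinearMap.fst R _ _ ∘ₗ h')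
    have hgs : Function.Surjective (powMap r p.g) := (p.pi r).surj
    obtain ⟨k', hk'⟩ := exists_lift (powMap r p.g) k fun x => hgs _
    obtain ⟨w, hw⟩ := exists_lift (powMap r p.f) (LinearMap.fst R _ _ ∘ₗ h' - k' ∘ₗ p.f)
      fun x => ((p.pi r).exact _).mp (by
        change powMap r p.g _ = 0
        rw [LinearMap.sub_apply, map_sub, LinearMap.comp_apply, LinearMap.comp_apply, hk', hk]
        simp)
    obtain ⟨c, hc⟩ := hg (LinearMap.snd R _ _ ∘ₗ h' - (∑ i, g i ∘ₗ LinearMap.proj i) ∘ₗ w)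
    let l : p.P₀ →ₗ[R] (Fin r → p.P₀) × R :=
      (k' - LinearMap.pi fun i => scalarEnd p.P₀ (c i)).prod 0
    have hl : ∀ y, l y = (k' y - fun i => algebraMap K R (c i) • y, 0) := fun _ => rfl
    refine ⟨D.mkQ ∘ₗ l, fun x => ?_⟩
    rw [← hh', LinearMap.comp_apply, ← sub_eq_zero, ← map_sub, hmk]
    refine ⟨-(w x + fun i => algebraMap K R (c i) • x), ?_⟩
    rw [map_neg, ← neg_sub, neg_inj, hF]
    have h1 := hw x
    have h2 := hc x
    simp only [LinearMap.sub_apply, LinearMap.comp_apply, LinearMap.fst_apply,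
      LinearMap.snd_apply, LinearMap.sum_apply, LinearMap.proj_apply] at h1 h2
    refine Prod.ext (funext fun i => ?_) ?_
    · have h3 := congrFun h1 i
      simp only [powMap_apply, Pi.sub_apply] at h3
      simp only [hl, Prod.fst_sub, Pi.add_apply, Pi.sub_apply, powMap_apply, map_add, h3, map_smul]
      abel
    · simp only [hl, Prod.snd_sub, Pi.add_apply, map_add, map_smul, Finset.sum_add_distrib, ← h2]
      abel
  · intro X _ _ _ hX
    obtain ⟨m, π, hπ⟩ := exists_power_surjection R X
    have key : ∀ j : Fin m, ∃ s : E →ₗ[R] X, s (D.mkQ (0, 1)) = π (Pi.single j 1) := by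
      intro j
      let φ : R →ₗ[R] X := π ∘ₗ LinearMap.single R (fun _ => R) j
      obtain ⟨k, hk⟩ := exists_extend_powMap hX r (φ ∘ₗ (∑ i, g i ∘ₗ LinearMap.proj i))
      refine ⟨D.liftQ ((-k).coprod φ) ?_, ?_⟩
      · rintro _ ⟨x, rfl⟩
        rw [LinearMap.mem_ker, hF, LinearMap.coprod_apply, LinearMap.neg_apply, hk]
        simp
      · refine (Submodule.liftQ_apply _ _ _).trans ?_
        simp [φ]
    choose s hs using key
    refine ⟨m, ∑ j, s j ∘ₗ LinearMap.proj j, fun x => ?_⟩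
    obtain ⟨y, rfl⟩ := hπ x
    refine ⟨fun j => y j • D.mkQ (0, 1), ?_⟩
    simp only [LinearMap.sum_apply, LinearMap.comp_apply, LinearMap.proj_apply, map_smul, hs]
    conv_rhs => rw [← Finset.univ_sum_single y]
    rw [map_sum]
    refine Finset.sum_congr rfl fun j _ => ?_
    rw [← map_smul, ← Pi.single_smul, smul_eq_mul, mul_one]
  · intro X _ _ hX (h : (Fin r → p.P₁) →ₗ[R] X)
    obtain ⟨k, hk⟩ := exists_extend_powMap hX r h
    refine ⟨k ∘ₗ LinearMap.fst R _ _, fun x => ?_⟩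
    change k (F x).1 = h x
    rw [hF, hk]
  · intro Q _ _ _ _ hQ
    have hJ : ∀ (f : Q →ₗ[R] R) (t : Q), f t ∈ radMod R R := by
      intro f t
      have h0 := LinearMap.congr_fun (hQ (D.mkQ ∘ₗ LinearMap.inr R _ _ ∘ₗ f)) t
      obtain ⟨x, hx⟩ := (hmk _).mp h0
      rw [hF] at hx
      have h2 : ∑ i, g i (x i) = f t := congrArg Prod.snd hx
      rw [← h2]
      exact Submodule.sum_mem _ fun i _ => map_mem_radMod (g i)
        (hp (congrFun (congrArg Prod.fst hx) i))
    obtain ⟨m, π, hπ⟩ := exists_power_surjection R Q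
    obtain ⟨σ, hσ⟩ := exists_lift π LinearMap.id fun x => hπ x
    refine subsingleton_of_radMod_eq_top (R := R) (top_le_iff.mp fun t _ => ?_)
    have ht : t = π (σ t) := (hσ t).symm
    rw [ht, ← Finset.univ_sum_single (σ t), map_sum]
    refine Submodule.sum_mem _ fun j _ => ?_
    exact map_mem_radMod (π ∘ₗ LinearMap.single R (fun _ => R) j) (hJ (LinearMap.proj j ∘ₗ σ) t)

end Bongartz

/-! ### Finiteness of τ-rigid modules -/

section TauRigidFinite

variable {M N U X : Type} [AddCommGroup M] [Module R M]
  [AddCommGroup N] [Module R N] [AddCommGroup U] [Module R U] [AddCommGroup X] [Module R X]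

theorem inAdd_pi_self (k : ℕ) : InAdd R (Fin k → M) M :=
  ⟨k, .of_equiv (LinearEquiv.refl R _)⟩

theorem inAdd_of_equiv (e : N ≃ₗ[R] M) : InAdd R N M := .of_retract (.of_equiv e)

theorem inAdd_refl : InAdd R M M := inAdd_of_equiv (LinearEquiv.refl R M)

theorem modRetract_prod_left : ModRetract R M (M × N) :=
  ⟨LinearMap.inl R M N, LinearMap.fst R M N, LinearMap.fst_comp_inl R M N⟩

theorem modRetract_prod_right : ModRetract R N (M × N) :=
  ⟨LinearMap.inr R M N, LinearMap.snd R M N, LinearMap.snd_comp_inr R M N⟩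

/-- A module with the same additive closure and without redundant summands. -/
theorem exists_reduced [IsArtinianRing R] [Module.Finite R M] :
    ∃ A : Submodule R M, ModRetract R A M ∧ InAdd R M A ∧
      ∀ e : Module.End R A, e * e = e → InAdd R A (LinearMap.range e) → LinearMap.range e = ⊤ := by
  let S : Set (Submodule R M) := {A | ModRetract R A M ∧ InAdd R M A}
  obtain ⟨A, ⟨hA, hA'⟩, hmin⟩ := WellFounded.has_min (r := (· < · : _ → _ → Prop)) wellFounded_lt S
    ⟨⊤, .of_equiv Submodule.topEquiv, inAdd_of_equiv Submodule.topEquiv.symm⟩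
  refine ⟨A, hA, hA', fun e he hadd => ?_⟩
  by_contra hne
  have eqv := Submodule.equivMapOfInjective A.subtype A.injective_subtype (LinearMap.range e)
  refine hmin ((LinearMap.range e).map A.subtype)
    ⟨(ModRetract.of_equiv eqv.symm).trans ((modRetract_range he).trans hA),
      hA'.trans (hadd.trans (inAdd_of_equiv eqv))⟩
    (lt_of_le_of_ne (Submodule.map_subtype_le _ _) fun heq => hne ?_)
  apply Submodule.map_injective_of_injective A.injective_subtype
  rw [heq, Submodule.map_subtype_top]

theorem exists_maximal_tauRigid (K : Type) [Field K] [Algebra K R] [FiniteDimensional K R]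
    [IsArtinianRing R] [Module.Finite R U] (hU : TauRigid R U) :
    ∃ T : ModuleCat.{0} R, Module.Finite R T ∧ TauRigid R T ∧ InAdd R U T ∧
      (∀ e : Module.End R T, e * e = e → InAdd R T (LinearMap.range e) →
        LinearMap.range e = ⊤) ∧
      (∀ (N : Type) [AddCommGroup N] [Module R N] [Module.Finite R N],
        TauRigid R (T × N) → InAdd R N T) ∧
      (∀ (Q : Type) [AddCommGroup Q] [Module R Q] [Module.Finite R Q] [Module.Projective R Q],
        (∀ h : Q →ₗ[R] T, h = 0) → Subsingleton Q) := by
  obtain ⟨p, hp⟩ := exists_minPres (R := R) (M := U)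
  have hUp : InT p.f U := by
    obtain ⟨q, hq⟩ := hU
    exact InT.of_inAdd_left hp inAdd_refl hq
  obtain ⟨E, q, hEfin, hEp, hgen, hpq, hQ⟩ := exists_bongartz K p hp hUp
  have hT : TauRigid R (E × U) :=
    ⟨q.prod p, (hpq _ (hEp.prod hUp)).presProd (hEp.prod hUp)⟩
  obtain ⟨A, hA, hA', hred⟩ := exists_reduced (R := R) (M := E × U)
  have hUA : InAdd R U A := (InAdd.of_retract modRetract_prod_right).trans hA'
  have hEA : InAdd R E A := (InAdd.of_retract modRetract_prod_left).trans hA'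
  have hfinA : Module.Finite R A := hA.finite
  refine ⟨.of R A, hfinA, hT.of_inAdd (.of_retract hA), hUA,
    hred, ?_, ?_⟩
  · intro N _ _ _ hN
    change TauRigid R (A × N) at hN
    change InAdd R N A
    obtain ⟨f', hf'⟩ := hN
    have hNf' : InT f'.f N := hf'.of_inAdd (.of_retract modRetract_prod_right)
    have hAf' : InT f'.f A := hf'.of_inAdd (.of_retract modRetract_prod_left)
    have hNp : InT p.f N :=
      InT.of_inAdd_left hp (hUA.trans (.of_retract modRetract_prod_left)) hNf'
    obtain ⟨m, s₁, hs₁⟩ := hgen N hNp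
    obtain ⟨l, u, hu⟩ := exists_hom_generators (R := R) K U N
    let s : (Fin m → E) × (Fin l → U) →ₗ[R] N := s₁.coprod (∑ i, u i ∘ₗ LinearMap.proj i)
    have hs : Function.Surjective s := fun y => by
      obtain ⟨x, rfl⟩ := hs₁ y
      exact ⟨(x, 0), by simp [s]⟩
    have : IsNoetherian R ((Fin m → E) × (Fin l → U)) :=
      isNoetherian_of_isNoetherianRing_of_finite R _
    have : Module.Finite R (LinearMap.ker s) := Module.IsNoetherian.finite R _
    have hfac : ∀ v : U →ₗ[R] N, ∃ v' : U →ₗ[R] (Fin m → E) × (Fin l → U), ∀ x, s (v' x) = v x := by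
      intro v
      obtain ⟨c, hc⟩ := hu v
      refine ⟨LinearMap.inr R _ _ ∘ₗ LinearMap.pi fun i => scalarEnd U (c i), fun x => ?_⟩
      simp [s, hc, scalarEnd]
    have hLp : InT p.f (LinearMap.ker s) := by
      intro h
      obtain ⟨k, hk⟩ := ((hEp.pi m).prod (hUp.pi l)) ((LinearMap.ker s).subtype ∘ₗ h)
      obtain ⟨v, hv⟩ := exists_descend p.surj (s ∘ₗ k) fun x hx => by
        obtain ⟨y, rfl⟩ := (p.exact x).mp hx
        rw [LinearMap.comp_apply, hk]
        exact (h y).2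
      obtain ⟨v', hv'⟩ := hfac v
      refine ⟨(k - v' ∘ₗ p.g).codRestrict _ fun x => ?_, fun x => Subtype.ext ?_⟩
      · rw [LinearMap.mem_ker, LinearMap.sub_apply, map_sub, LinearMap.comp_apply, hv', hv,
          LinearMap.comp_apply, sub_self]
      · simp [hk, p.g_f]
    have hLf' : InT f'.f (LinearMap.ker s) := by
      obtain ⟨m', s', hs'⟩ := hgen _ hLp
      exact ((hAf'.of_inAdd hEA).pi m').of_surjective s' hs'
    obtain ⟨a, ha⟩ := exists_lift s (LinearMap.snd R A N ∘ₗ f'.g) fun x => hs _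
    obtain ⟨k, hk⟩ := hLf' ((a ∘ₗ f'.f).codRestrict (LinearMap.ker s) fun x => by
      rw [LinearMap.mem_ker, LinearMap.comp_apply, ha, LinearMap.comp_apply, f'.g_f, map_zero])
    obtain ⟨d, hd⟩ := exists_descend f'.surj (a - (LinearMap.ker s).subtype ∘ₗ k) fun x hx => by
      obtain ⟨y, rfl⟩ := (f'.exact x).mp hx
      simp [hk]
    have hsd : ∀ y, s (d y) = y.2 := fun y => by
      obtain ⟨x, rfl⟩ := f'.surj y
      have h0 : s (k x) = 0 := (k x).2
      rw [hd, LinearMap.sub_apply, map_sub, ha, LinearMap.comp_apply, LinearMap.comp_apply,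
        Submodule.subtype_apply, h0, sub_zero, LinearMap.snd_apply]
    have hNT : ModRetract R N ((Fin m → E) × (Fin l → U)) :=
      ⟨d ∘ₗ LinearMap.inr R A N, s, LinearMap.ext fun y => hsd _⟩
    exact (InAdd.of_retract hNT).trans
      (((inAdd_pi_self m).trans hEA).prod ((inAdd_pi_self l).trans hUA))
  · intro Q _ _ _ _ h
    refine hQ Q fun g => ?_
    obtain ⟨k, i, π, hi⟩ := hEA
    have : i ∘ₗ g = 0 := by
      refine LinearMap.ext fun x => funext fun j => ?_
      exact LinearMap.congr_fun (h (LinearMap.proj j ∘ₗ i ∘ₗ g)) x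
    rw [← LinearMap.id_comp g, ← hi, LinearMap.comp_assoc, this, LinearMap.comp_zero]

theorem isTauRigidMod_iff (M : ModCat R) : IsTauRigidMod M ↔ TauRigid R M := by
  constructor
  · rintro ⟨P₁, P₀, f, g, h₁, h₀, f₁, f₀, hg, hfg, h⟩
    refine ⟨⟨P₁, P₀, f.hom, g.hom, f₁, f₀, (IsProjective.iff_projective _).mpr h₁,
      (IsProjective.iff_projective _).mpr h₀, hg, hfg⟩, fun k => ?_⟩
    obtain ⟨l, hl⟩ := h (ModuleCat.ofHom k)
    exact ⟨l.hom, fun x => by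
      have := congrArg (fun t => t.hom x) hl
      simpa using this⟩
  · rintro ⟨p, hp⟩
    refine ⟨p.P₁, p.P₀, ModuleCat.ofHom p.f, ModuleCat.ofHom p.g,
      (IsProjective.iff_projective _).mp p.proj₁,
      (IsProjective.iff_projective _).mp p.proj₀, p.fin₁, p.fin₀, p.surj, p.exact, fun k => ?_⟩
    obtain ⟨l, hl⟩ := hp k.hom
    exact ⟨ModuleCat.ofHom l, by ext x; exact hl x⟩

theorem memAddMod_of_inAdd {N M : ModCat R} (h : InAdd R N M) : MemAddMod N M := by
  obtain ⟨k, i, p, h⟩ := h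
  let e := ModuleCat.biproductIsoPi (fun _ : Fin k => M)
  refine ⟨k, ModuleCat.ofHom i ≫ e.inv, e.hom ≫ ModuleCat.ofHom p, ?_⟩
  rw [Category.assoc, e.inv_hom_id_assoc, ← ModuleCat.ofHom_comp, h]
  rfl

theorem exists_support_tauTilting (K : Type) [Field K] [Algebra K R] [FiniteDimensional K R]
    [IsArtinianRing R] [Module.Finite R U] (hU : TauRigid R U) :
    ∃ T : ModCat R, Module.Finite R T ∧ IsSupportTauTiltingMod T ∧ IsBasicMod T ∧ InAdd R U T := by
  obtain ⟨T, hfin, hT, hUT, hred, hmax, hQ⟩ := exists_maximal_tauRigid K hU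
  have hfin₀ : Module.Finite R PUnit := .of_surjective (0 : T →ₗ[R] PUnit) fun _ => ⟨0, rfl⟩
  refine ⟨T, hfin, ⟨ModuleCat.of R PUnit, ⟨hfin, (isTauRigidMod_iff T).mpr hT,
    hfin₀, (IsProjective.iff_projective _).mp inferInstance, fun f => ?_⟩, ?_⟩, ?_, hUT⟩
  · ext x
    have : x = 0 := Subsingleton.elim (α := PUnit) _ _
    rw [this, map_zero, map_zero]
  · rintro N Q ⟨hf, hr, hPf, hPp, hz⟩
    let e := (ModuleCat.biprodIsoProd T N).toLinearEquiv
    let e' := (ModuleCat.biprodIsoProd (ModuleCat.of R PUnit) Q).toLinearEquiv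
    have : Module.Finite R (T ⊞ N : ModCat R) := hf
    have : Module.Finite R (ModuleCat.of R PUnit ⊞ Q : ModCat R) := hPf
    have : Module.Projective R (ModuleCat.of R PUnit ⊞ Q : ModCat R) :=
      (IsProjective.iff_projective _).mpr hPp
    have hN : ModRetract R N (T ⊞ N : ModCat R) :=
      modRetract_prod_right.trans (.of_equiv e.symm)
    have hT' : ModRetract R T (T ⊞ N : ModCat R) :=
      modRetract_prod_left.trans (.of_equiv e.symm)
    have hQ' : ModRetract R Q (ModuleCat.of R PUnit ⊞ Q : ModCat R) :=
      modRetract_prod_right.trans (.of_equiv e'.symm)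
    have := hN.finite
    have := hQ'.finite
    have := hQ'.projective
    refine ⟨memAddMod_of_inAdd (hmax N (((isTauRigidMod_iff _).mp hr).of_inAdd
      (inAdd_of_equiv e.symm))), ?_⟩
    have : Subsingleton Q := hQ Q fun h => by
      obtain ⟨i, π, hi⟩ := hQ'
      obtain ⟨i', π', hi'⟩ := hT'
      have h0 := hz (ModuleCat.ofHom (i' ∘ₗ h ∘ₗ π))
      ext x
      have h1 := congrArg (fun t => π' (t.hom (i x))) h0
      simp only [ModuleCat.hom_ofHom, LinearMap.comp_apply, ModuleCat.hom_zero,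
        LinearMap.zero_apply, map_zero] at h1
      have h2 : π (i x) = x := LinearMap.congr_fun hi x
      have h3 : π' (i' (h x)) = h x := LinearMap.congr_fun hi' _
      rw [h2, h3] at h1
      exact h1
    refine memAddMod_of_inAdd ⟨0, 0, 0, ?_⟩
    ext x
    exact Subsingleton.elim _ _
  · rintro N X ⟨φ⟩
    let ε : T ≃ₗ[R] (N × N) × X :=
      φ.toLinearEquiv ≪≫ₗ (ModuleCat.biprodIsoProd (N ⊞ N) X).toLinearEquiv ≪≫ₗ
        (ModuleCat.biprodIsoProd N N).toLinearEquiv.prodCongr (LinearEquiv.refl R X)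
    let e₀ : Module.End R ((N × N) × X) :=
      ((0 : N →ₗ[R] N).prodMap LinearMap.id).prodMap LinearMap.id
    let s₀ : Module.End R ((N × N) × X) :=
      (LinearEquiv.prodComm R N N).toLinearMap.prodMap LinearMap.id
    have he₀ : ∀ a b c, e₀ ((a, b), c) = ((0, b), c) := fun a b c => rfl
    have hs₀ : ∀ a b c, s₀ ((a, b), c) = ((b, a), c) := fun a b c => rfl
    let e : Module.End R T := ε.symm.toLinearMap ∘ₗ e₀ ∘ₗ ε.toLinearMap
    let s : Module.End R T := ε.symm.toLinearMap ∘ₗ s₀ ∘ₗ ε.toLinearMap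
    have he : ∀ y, e (ε.symm y) = ε.symm (e₀ y) := fun y => by simp [e]
    have hs : ∀ y, s (ε.symm y) = ε.symm (s₀ y) := fun y => by simp [s]
    have hee : e * e = e := by
      ext x
      obtain ⟨⟨⟨a, b⟩, c⟩, rfl⟩ := ε.symm.surjective x
      rw [Module.End.mul_apply, he, he, he₀, he₀]
    have htop := hred e hee (InAdd.of_sum (ι := Bool)
      (fun j => cond j e.rangeRestrict (e.rangeRestrict ∘ₗ s))
      (fun j => cond j (Submodule.subtype _) ((1 - e) ∘ₗ s ∘ₗ Submodule.subtype _)) fun x => by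
        obtain ⟨⟨⟨a, b⟩, c⟩, rfl⟩ := ε.symm.surjective x
        rw [Fintype.sum_bool]
        set x := ε.symm ((a, b), c) with hx
        change e x + (s (e (s x)) - e (s (e (s x)))) = x
        rw [hx, hs, hs₀, he, he, he₀, he₀, hs, hs₀, he, he₀, ← map_sub, ← map_add]
        simp)
    have hN : Subsingleton N := by
      refine ⟨fun a b => ?_⟩
      have key : ∀ a : N, a = 0 := fun a => by
        obtain ⟨y, hy⟩ := LinearMap.range_eq_top.mp htop (ε.symm ((a, 0), 0))
        obtain ⟨⟨⟨a', b'⟩, c'⟩, rfl⟩ := ε.symm.surjective y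
        rw [he, he₀] at hy
        exact (congrArg (fun t => t.1.1) (ε.symm.injective hy)).symm
      rw [key a, key b]
    exact ModuleCat.isZero_of_subsingleton N

theorem finIso_indec_tauRigid (K : Type) [Field K] [Algebra K R] [FiniteDimensional K R]
    [IsArtinianRing R] (ht : IsTauTiltingFiniteRing R) :
    FinIso fun U : ModuleCat.{0} R => Module.Finite R U ∧ Indec R U ∧ TauRigid R U := by
  obtain ⟨n, f, hf⟩ := ht
  have key : ∀ i : Fin n, FinIso fun U : ModuleCat.{0} R =>
      Module.Finite R (f i) ∧ Indec R U ∧ ModRetract R U (f i) := by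
    intro i
    by_cases hi : Module.Finite R (f i)
    · exact (finIso_indec_retract (R := R) (f i)).mono fun U hU => hU.2
    · exact ⟨[], fun U hU => absurd hU.1 hi⟩
  refine (FinIso.exists_fin key).mono fun U ⟨hUf, hU, hUt⟩ => ?_
  obtain ⟨T, hfin, hT, hTb, hUT⟩ := exists_support_tauTilting K hUt
  obtain ⟨i, ⟨φ⟩⟩ := hf T hT hTb
  refine ⟨i, Module.Finite.equiv φ.toLinearEquiv, hU, ?_⟩
  exact (hU.retract_of_inAdd hUT).trans (.of_equiv φ.toLinearEquiv)

end TauRigidFinite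

/-! ### Syzygies over quasi-Frobenius rings -/

/-- An artinian self-injective ring over which finitely generated modules embed in free modules. -/
class QuasiFrobenius (R : Type) [Ring R] : Prop where
  artinian : IsArtinianRing R
  extend {M N : Type} [AddCommGroup M] [Module R M] [AddCommGroup N] [Module R N]
    {i : M →ₗ[R] N} (hi : Function.Injective i) : InT i R
  embed (M : Type) [AddCommGroup M] [Module R M] [Module.Finite R M] :
    ∃ (n : ℕ) (i : M →ₗ[R] (Fin n → R)), Function.Injective i

attribute [instance] QuasiFrobenius.artinian

section Syzygies

variable {K M N P P' Q X Y Z : Type} [AddCommGroup K] [Module R K] [AddCommGroup M] [Module R M]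
  [AddCommGroup N] [Module R N] [AddCommGroup P] [Module R P] [AddCommGroup P'] [Module R P']
  [AddCommGroup Q] [Module R Q] [AddCommGroup X] [Module R X] [AddCommGroup Y] [Module R Y]
  [AddCommGroup Z] [Module R Z]

theorem exists_corestrict {i : M →ₗ[R] P} (hi : Function.Injective i) (h : X →ₗ[R] P)
    (hr : ∀ x, ∃ y, i y = h x) : ∃ k : X →ₗ[R] M, ∀ x, i (k x) = h x := by
  refine ⟨(LinearEquiv.ofInjective i hi).symm ∘ₗ h.codRestrict (LinearMap.range i) hr, fun x => ?_⟩
  exact congrArg Subtype.val ((LinearEquiv.ofInjective i hi).apply_symm_apply _)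

variable (R P) in
theorem exists_retract_pow [Module.Finite R P] [Module.Projective R P] :
    ∃ n, ModRetract R P (Fin n → R) := by
  obtain ⟨n, f, hf⟩ := exists_power_surjection R P
  obtain ⟨s, hs⟩ := Module.projective_lifting_property f LinearMap.id hf
  exact ⟨n, s, f, hs⟩

theorem InT.of_projective [QuasiFrobenius R] [Module.Finite R P] [Module.Projective R P]
    {i : M →ₗ[R] N} (hi : Function.Injective i) : InT i P := by
  obtain ⟨n, s, f, hs⟩ := exists_retract_pow R P
  intro h
  obtain ⟨k, hk⟩ := (QuasiFrobenius.extend hi).pi n (s ∘ₗ h)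
  exact ⟨f ∘ₗ k, fun x => by
    rw [LinearMap.comp_apply, hk]
    exact LinearMap.congr_fun hs _⟩

/-- A short exact sequence `0 → M → P → N → 0`. -/
structure IsSES (i : M →ₗ[R] P) (p : P →ₗ[R] N) : Prop where
  inj : Function.Injective i
  surj : Function.Surjective p
  exact : Function.Exact i p

theorem IsSES.p_i {i : M →ₗ[R] P} {p : P →ₗ[R] N} (h : IsSES i p) (x : M) : p (i x) = 0 :=
  h.exact.apply_apply_eq_zero x

theorem isSES_ker {p : P →ₗ[R] N} (hp : Function.Surjective p) :
    IsSES (LinearMap.ker p).subtype p :=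
  ⟨Submodule.injective_subtype _, hp, LinearMap.exact_subtype_ker_map p⟩

/-- A weak form of Schanuel's lemma. -/
theorem IsSES.retract_left [Module.Projective R P] [Module.Projective R P'] {i : M →ₗ[R] P}
    {p : P →ₗ[R] N} (h : IsSES i p) {i' : K →ₗ[R] P'} {p' : P' →ₗ[R] N} (h' : IsSES i' p') :
    ModRetract R M (K × P) := by
  obtain ⟨a, ha⟩ := exists_lift p' p fun x => h'.surj _
  obtain ⟨b, hb⟩ := exists_lift p p' fun x => h.surj _
  obtain ⟨k, hk⟩ := exists_corestrict h'.inj (a ∘ₗ i) fun x => (h'.exact _).mp (by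
    rw [LinearMap.comp_apply, ha, h.p_i])
  obtain ⟨l, hl⟩ := exists_corestrict h.inj (b ∘ₗ i') fun x => (h.exact _).mp (by
    rw [LinearMap.comp_apply, hb, h'.p_i])
  obtain ⟨t, ht⟩ := exists_corestrict h.inj (LinearMap.id - b ∘ₗ a) fun x => (h.exact _).mp (by
    simp [hb, ha])
  refine ⟨k.prod i, l.coprod t, LinearMap.ext fun x => h.inj ?_⟩
  simp [hl, hk, ht]

theorem IsSES.retract_right [QuasiFrobenius R] [Module.Finite R P] [Module.Finite R P']
    [Module.Projective R P] [Module.Projective R P'] {i : M →ₗ[R] P}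
    {p : P →ₗ[R] N} (h : IsSES i p) {i' : M →ₗ[R] P'} {p' : P' →ₗ[R] K} (h' : IsSES i' p') :
    ModRetract R N (K × P) := by
  obtain ⟨a, ha⟩ := InT.of_projective h.inj i'
  obtain ⟨b, hb⟩ := InT.of_projective h'.inj i
  obtain ⟨k, hk⟩ := exists_descend h.surj (p' ∘ₗ a) fun x hx => by
    obtain ⟨y, rfl⟩ := (h.exact x).mp hx
    rw [LinearMap.comp_apply, ha, h'.p_i]
  obtain ⟨l, hl⟩ := exists_descend h'.surj (p ∘ₗ b) fun x hx => by
    obtain ⟨y, rfl⟩ := (h'.exact x).mp hx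
    rw [LinearMap.comp_apply, hb, h.p_i]
  obtain ⟨t, ht⟩ := exists_descend h.surj (LinearMap.id - b ∘ₗ a) fun x hx => by
    obtain ⟨y, rfl⟩ := (h.exact x).mp hx
    simp [hb, ha]
  refine ⟨k.prod t, l.coprod p, LinearMap.ext fun y => ?_⟩
  obtain ⟨x, rfl⟩ := h.surj y
  simp [hl, hk, ht]

theorem IsSES.projective_left [QuasiFrobenius R] [Module.Projective R P] [Module.Finite R M]
    [Module.Projective R M] {i : M →ₗ[R] P} {p : P →ₗ[R] N} (h : IsSES i p) :
    Module.Projective R N := by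
  obtain ⟨r, hr⟩ := InT.of_projective h.inj (LinearMap.id : M →ₗ[R] M)
  obtain ⟨s, hs⟩ := exists_descend h.surj (LinearMap.id - i ∘ₗ r) fun x hx => by
    obtain ⟨y, rfl⟩ := (h.exact x).mp hx
    simp [hr]
  refine Module.Projective.of_split s p (LinearMap.ext fun y => ?_)
  obtain ⟨x, rfl⟩ := h.surj y
  simp [hs, h.p_i]

/-- The homomorphism `u` factors through a finitely generated free module. -/
def FactorsProj (u : X →ₗ[R] Y) : Prop :=
  ∃ (n : ℕ) (a : X →ₗ[R] (Fin n → R)) (b : (Fin n → R) →ₗ[R] Y), ∀ x, b (a x) = u x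

theorem FactorsProj.of_comp [Module.Finite R P] [Module.Projective R P] {u : X →ₗ[R] Y}
    (a : X →ₗ[R] P) (b : P →ₗ[R] Y) (h : ∀ x, b (a x) = u x) : FactorsProj u := by
  obtain ⟨n, s, f, hs⟩ := exists_retract_pow R P
  refine ⟨n, s ∘ₗ a, b ∘ₗ f, fun x => ?_⟩
  rw [← h]
  exact congrArg b (LinearMap.congr_fun hs (a x))

theorem FactorsProj.lift {u : X →ₗ[R] Y} (h : FactorsProj u) {p : P →ₗ[R] Y}
    (hp : Function.Surjective p) : ∃ v : X →ₗ[R] P, ∀ x, p (v x) = u x := by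
  obtain ⟨n, a, b, h⟩ := h
  obtain ⟨b', hb'⟩ := exists_lift p b fun x => hp _
  exact ⟨b' ∘ₗ a, fun x => by rw [LinearMap.comp_apply, hb', h]⟩

theorem FactorsProj.extend [QuasiFrobenius R] {u : X →ₗ[R] Y} (h : FactorsProj u) {i : X →ₗ[R] Z}
    (hi : Function.Injective i) : ∃ v : Z →ₗ[R] Y, ∀ x, v (i x) = u x := by
  obtain ⟨n, a, b, h⟩ := h
  obtain ⟨a', ha'⟩ := (QuasiFrobenius.extend hi).pi n a
  exact ⟨b ∘ₗ a', fun x => by rw [LinearMap.comp_apply, ha', h]⟩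

variable (R X Y) in
/-- All homomorphisms from `X` to `Y` vanish in the stable category. -/
def StabZero : Prop := ∀ u : X →ₗ[R] Y, FactorsProj u

theorem StabZero.of_equiv {X' Y' : Type} [AddCommGroup X'] [Module R X'] [AddCommGroup Y']
    [Module R Y'] (h : StabZero R X Y) (e : X ≃ₗ[R] X') (f : Y ≃ₗ[R] Y') : StabZero R X' Y' := by
  intro u
  obtain ⟨n, a, b, hab⟩ := h (f.symm ∘ₗ u ∘ₗ e)
  exact ⟨n, a ∘ₗ e.symm, f ∘ₗ b, fun x => by simp [hab]⟩

theorem StabZero.shift [QuasiFrobenius R] [Module.Projective R P]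
    [Module.Finite R P'] [Module.Projective R P'] {i : M →ₗ[R] P} {p : P →ₗ[R] N} (h : IsSES i p)
    {i' : X →ₗ[R] P'} {p' : P' →ₗ[R] Y} (h' : IsSES i' p') (hz : StabZero R M X) :
    StabZero R N Y := by
  intro u
  obtain ⟨a, ha⟩ := exists_lift p' (u ∘ₗ p) fun x => h'.surj _
  obtain ⟨k, hk⟩ := exists_corestrict h'.inj (a ∘ₗ i) fun x => (h'.exact _).mp (by
    rw [LinearMap.comp_apply, ha, LinearMap.comp_apply, h.p_i, map_zero])
  obtain ⟨t, ht⟩ := (hz k).extend h.inj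
  obtain ⟨v, hv⟩ := exists_descend h.surj (a - i' ∘ₗ t) fun x hx => by
    obtain ⟨y, rfl⟩ := (h.exact x).mp hx
    simp [ht, hk]
  refine FactorsProj.of_comp v p' fun y => ?_
  obtain ⟨x, rfl⟩ := h.surj y
  simp [h'.p_i, hv, ha, LinearMap.sub_apply]

/-- Finitely generated indecomposable modules which are not projective. -/
structure Stab (R : Type) [Ring R] (M : Type) [AddCommGroup M] [Module R M] : Prop where
  finite : Module.Finite R M
  indec : Indec R M
  not_projective : ¬ Module.Projective R M

theorem modRetract_of_isUnit {a : M →ₗ[R] N} {b : N →ₗ[R] M}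
    (h : IsUnit (b ∘ₗ a : Module.End R M)) : ModRetract R M N := by
  obtain ⟨v, hv⟩ := h.exists_left_inv
  exact ⟨a, v ∘ₗ b, hv⟩

theorem Indec.retract_of_prod [IsArtinianRing R] [Module.Finite R M] (h : Indec R M)
    (hr : ModRetract R M (K × P)) : ModRetract R M K ∨ ModRetract R M P := by
  obtain ⟨i, p, hip⟩ := hr
  have := h.isLocalRing
  have h1 : (p ∘ₗ LinearMap.inl R K P) ∘ₗ (LinearMap.fst R K P ∘ₗ i) +
      (p ∘ₗ LinearMap.inr R K P) ∘ₗ (LinearMap.snd R K P ∘ₗ i) = (1 : Module.End R M) := by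
    refine LinearMap.ext fun x => ?_
    refine Eq.trans ?_ (LinearMap.congr_fun hip x)
    simp [← map_add]
  exact (IsLocalRing.isUnit_or_isUnit_of_add_one h1).imp modRetract_of_isUnit modRetract_of_isUnit

theorem Stab.retract_of_prod [IsArtinianRing R] [Module.Projective R P] (h : Stab R M)
    (hr : ModRetract R M (K × P)) : ModRetract R M K :=
  have := h.finite
  (h.indec.retract_of_prod hr).resolve_right fun h' => h.not_projective h'.projective

theorem Stab.equiv_of_retract_prod [IsArtinianRing R] [Module.Projective R P] (h : Stab R M)
    (hK : Stab R K) (hr : ModRetract R M (K × P)) : Nonempty (M ≃ₗ[R] K) :=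
  have := h.indec.1
  hK.indec.equiv_of_retract (h.retract_of_prod hr)

theorem eq_zero_of_idempotent_of_range_le [Module.Finite R M] {e : Module.End R M} (he : e * e = e)
    (h : ∀ x, e x ∈ radMod R M) : e = 0 := by
  have h1 : LinearMap.ker e = ⊤ := eq_top_of_sup_radMod (eq_top_iff.mpr fun x _ => by
    refine Submodule.mem_sup.mpr ⟨x - e x, ?_, e x, h x, by simp⟩
    have := LinearMap.congr_fun he x
    rw [LinearMap.mem_ker, map_sub, sub_eq_zero]
    exact this.symm)
  exact LinearMap.ker_eq_top.mp h1

theorem IsSES.stab_left [QuasiFrobenius R] [Module.Finite R P] [Module.Projective R P]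
    {i : M →ₗ[R] P} {p : P →ₗ[R] N} (h : IsSES i p) (hi : ∀ x, i x ∈ radMod R P)
    (hN : Stab R N) : Stab R M := by
  have hfin : Module.Finite R M := by
    have : IsNoetherian R P := isNoetherian_of_isNoetherianRing_of_finite R P
    exact Module.Finite.of_injective i h.inj
  have hproj : ¬ Module.Projective R M := fun _ => hN.not_projective h.projective_left
  have := hN.finite
  refine ⟨hfin, ⟨?_, fun π hπ => ?_⟩, hproj⟩
  · by_contra hM
    have := not_nontrivial_iff_subsingleton.mp hM
    exact hproj inferInstance
  have key : ∀ π : Module.End R M, π * π = π → ∀ q : Module.End R P, (∀ x, q (i x) = i (π x)) →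
      ∀ n : Module.End R N, (∀ x, n (p x) = p (q x)) → IsNilpotent n → π = 0 := by
    rintro π hπ q hq n hn ⟨k, hk⟩
    have hnk : ∀ k x, (n ^ k) (p x) = p ((q ^ k) x) := by
      intro k x
      induction k with
      | zero => rfl
      | succ k ih => rw [pow_succ', pow_succ', Module.End.mul_apply, ih, hn, Module.End.mul_apply]
    have hqk : ∀ k x, (q ^ (k + 1)) (i x) = i (π x) := by
      intro k x
      induction k with
      | zero => rw [zero_add, pow_one, hq]
      | succ k ih =>
        rw [pow_succ', Module.End.mul_apply, ih, hq]
        exact congrArg i (LinearMap.congr_fun hπ x)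
    obtain ⟨θ, hθ⟩ := exists_corestrict h.inj (q ^ (k + 1)) fun x => (h.exact _).mp (by
      rw [← hnk, pow_succ', Module.End.mul_apply, hk, LinearMap.zero_apply, map_zero])
    refine eq_zero_of_idempotent_of_range_le hπ fun x => ?_
    have : π x = θ (i x) := h.inj (by rw [hθ, hqk])
    rw [this]
    exact map_mem_radMod θ (hi x)
  obtain ⟨q, hq⟩ := InT.of_projective h.inj (i ∘ₗ π)
  obtain ⟨n, hn⟩ := exists_descend h.surj (p ∘ₗ q) fun x hx => by
    obtain ⟨y, rfl⟩ := (h.exact x).mp hx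
    rw [LinearMap.comp_apply, hq, LinearMap.comp_apply, h.p_i]
  obtain ⟨w, hw⟩ := exists_descend h.surj (q * (1 - q)) fun x hx => by
    obtain ⟨y, rfl⟩ := (h.exact x).mp hx
    have : π (π y) = π y := LinearMap.congr_fun hπ y
    simp [hq, this]
  have hnw : ∀ x, n ((1 - n) x) = p (w x) := fun x => by
    obtain ⟨x, rfl⟩ := h.surj x
    simp [hw, hn]
  have hnu : ¬ IsUnit (n * (1 - n)) := fun hu => by
    obtain ⟨v, hv⟩ := hu.exists_right_inv
    refine hN.not_projective (Module.Projective.of_split (w ∘ₗ v) p (LinearMap.ext fun x => ?_))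
    rw [LinearMap.comp_apply, LinearMap.comp_apply, ← hnw]
    exact LinearMap.congr_fun hv x
  have hcomm : Commute n (1 - n) := (Commute.one_right n).sub_right (Commute.refl n)
  rcases hN.indec.isNilpotent_or_isUnit n with hn' | hn'
  · exact Or.inl (key π hπ q hq n hn hn')
  · right
    rcases hN.indec.isNilpotent_or_isUnit (1 - n) with hn'' | hn''
    · refine (sub_eq_zero.mp (key (1 - π) ?_ (1 - q) ?_ (1 - n) ?_ hn'')).symm
      · rw [mul_sub, sub_mul, sub_mul, hπ]
        simp
      · intro x
        simp [hq]
      · intro x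
        simp [hn]
    · exact absurd (hn'.mul hn'') hnu

/-- Every nonprojective indecomposable summand of a kernel of a projective presentation is a
syzygy of a nonprojective indecomposable module. -/
theorem Stab.exists_cosyzygy_of_retract [QuasiFrobenius R] [Module.Finite R P]
    [Module.Projective R P] {p : P →ₗ[R] N} (h : Stab R M) (hp : Function.Surjective p)
    (hr : ModRetract R M (LinearMap.ker p)) :
    ∃ (X : Type) (_ : AddCommGroup X) (_ : Module R X) (Q : Type) (_ : AddCommGroup Q)
      (_ : Module R Q) (q : Q →ₗ[R] X), Stab R X ∧ Module.Finite R Q ∧ Module.Projective R Q ∧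
        Function.Surjective q ∧ ModRetract R M (LinearMap.ker q) := by
  have hfin : Module.Finite R N := .of_surjective p hp
  let S : Set (Submodule R N) := {A | ∃ (Q : Type) (_ : AddCommGroup Q)
      (_ : Module R Q) (q : Q →ₗ[R] A), Module.Finite R Q ∧ Module.Projective R Q ∧
        Function.Surjective q ∧ ModRetract R M (LinearMap.ker q)}
  have hS : ⊤ ∈ S := by
    let t : N ≃ₗ[R] (⊤ : Submodule R N) := Submodule.topEquiv.symm
    refine ⟨P, _, _, t.toLinearMap ∘ₗ p, inferInstance, inferInstance, t.surjective.comp hp, ?_⟩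
    rwa [LinearEquiv.ker_comp]
  obtain ⟨A, ⟨Q, _, _, q, hQ, hQ', hq, hrq⟩, hmin⟩ :=
    WellFounded.has_min (r := (· < · : _ → _ → Prop)) wellFounded_lt S ⟨⊤, hS⟩
  have hA : Module.Finite R A := .of_surjective q hq
  refine ⟨A, _, _, Q, _, _, q, ⟨hA, ⟨?_, fun e he => ?_⟩, fun hAp => ?_⟩, hQ, hQ', hq, hrq⟩
  · by_contra hA'
    have := not_nontrivial_iff_subsingleton.mp hA'
    have htop : LinearMap.ker q = ⊤ := eq_top_iff.mpr fun x _ => Subsingleton.elim _ _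
    rw [htop] at hrq
    exact h.not_projective (hrq.trans (.of_equiv Submodule.topEquiv)).projective
  · by_contra! hne
    have hlt : ∀ e : Module.End R A, e * e = e → e ≠ 1 →
        (LinearMap.range e).map A.subtype < A := fun e he hne => by
      refine lt_of_le_of_ne (Submodule.map_subtype_le _ _) fun heq => hne ?_
      have htop : LinearMap.range e = ⊤ := by
        apply Submodule.map_injective_of_injective A.injective_subtype
        rw [heq, Submodule.map_subtype_top]
      refine LinearMap.ext fun x => ?_
      obtain ⟨y, rfl⟩ := LinearMap.range_eq_top.mp htop x
      exact LinearMap.congr_fun he y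
    have hnot : ∀ e : Module.End R A, e * e = e → e ≠ 1 → ∀ (Q : Type) [AddCommGroup Q]
        [Module R Q] [Module.Finite R Q] [Module.Projective R Q]
        (q : Q →ₗ[R] LinearMap.range e), Function.Surjective q →
        ¬ ModRetract R M (LinearMap.ker q) := fun e he hne Q _ _ _ _ q hq hr => by
      let eqv := Submodule.equivMapOfInjective A.subtype A.injective_subtype (LinearMap.range e)
      refine hmin _ ⟨Q, _, _, eqv.toLinearMap ∘ₗ q, inferInstance, inferInstance,
        eqv.surjective.comp hq, ?_⟩ (hlt e he hne)
      rwa [LinearEquiv.ker_comp]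
    have he' : (1 - e) * (1 - e) = 1 - e := by
      simp [mul_sub, sub_mul, he]
    have hne' : 1 - e ≠ 1 := fun h1 => hne.1 (by simpa using h1)
    have hf₁ : Module.Finite R (LinearMap.range e) := (modRetract_range he).finite
    have hf₂ : Module.Finite R (LinearMap.range (1 - e)) := (modRetract_range he').finite
    obtain ⟨m, f, hf⟩ := exists_power_surjection R (LinearMap.range e)
    obtain ⟨l, g, hg⟩ := exists_power_surjection R (LinearMap.range (1 - e))
    let s : (Fin m → R) × (Fin l → R) →ₗ[R] A :=
      (Submodule.subtype _ ∘ₗ f).coprod (Submodule.subtype _ ∘ₗ g)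
    have hs : Function.Surjective s := fun x => by
      obtain ⟨a, ha⟩ := hf ⟨e x, x, rfl⟩
      obtain ⟨b, hb⟩ := hg ⟨(1 - e) x, x, rfl⟩
      exact ⟨(a, b), by simp [s, ha, hb]⟩
    have h0 : ∀ a b, s (a, b) = 0 → f a = 0 ∧ g b = 0 := by
      intro a b hab
      obtain ⟨x, hx⟩ := (f a).2
      obtain ⟨y, hy⟩ := (g b).2
      have h1 : (f a : A) + g b = 0 := by simpa [s] using hab
      rw [← hx, ← hy] at h1
      have h2 : ∀ x, e (e x) = e x := fun x => LinearMap.congr_fun he x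
      have h3 : e x = 0 := by
        have := congrArg e h1
        simpa [h2] using this
      refine ⟨Subtype.ext (hx.symm.trans h3), Subtype.ext (hy.symm.trans ?_)⟩
      rwa [h3, zero_add] at h1
    have hker : ModRetract R (LinearMap.ker s) (LinearMap.ker f × LinearMap.ker g) := by
      refine ⟨((LinearMap.fst R _ _ ∘ₗ Submodule.subtype _).codRestrict _ fun x =>
          (h0 _ _ x.2).1).prod ((LinearMap.snd R _ _ ∘ₗ Submodule.subtype _).codRestrict _
          fun x => (h0 _ _ x.2).2),
        ((Submodule.subtype _).prodMap (Submodule.subtype _)).codRestrict _ fun x => ?_, ?_⟩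
      · simp [s]
      · rfl
    have hM := h.retract_of_prod (hrq.trans ((isSES_ker hq).retract_left (isSES_ker hs)))
    have := h.finite
    rcases h.indec.retract_of_prod (hM.trans hker) with hM' | hM'
    · exact hnot e he hne.2 _ f hf hM'
    · exact hnot (1 - e) he' hne' _ g hg hM'
  · have hz : IsSES (0 : PUnit →ₗ[R] A) (LinearMap.id : A →ₗ[R] A) :=
      ⟨fun _ _ _ => rfl, fun x => ⟨x, rfl⟩, fun x =>
        ⟨fun hx => ⟨0, by rw [map_zero]; exact hx.symm⟩, fun ⟨y, hy⟩ => hy.symm⟩⟩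
    exact h.not_projective (hrq.trans ((isSES_ker hq).retract_left hz)).projective

end Syzygies

/-! ### The syzygy permutation -/

section StableClasses

/-- `M` is the syzygy of `N`. -/
def Syz (M N : ModuleCat.{0} R) : Prop :=
  ∃ (P : ModuleCat.{0} R) (i : M →ₗ[R] P) (p : P →ₗ[R] N), Module.Finite R P ∧
    Module.Projective R P ∧ IsSES i p ∧ ∀ x, i x ∈ radMod R P

variable (R) in
/-- Bundled finitely generated nonprojective indecomposable modules. -/
def StabObj : Type 1 := {M : ModuleCat.{0} R // Stab R M}

variable (R) in
/-- Isomorphism of bundled modules. -/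
def stabSetoid : Setoid (StabObj R) where
  r M N := Nonempty (M.1 ≃ₗ[R] N.1)
  iseqv := ⟨fun _ => ⟨LinearEquiv.refl R _⟩, fun ⟨e⟩ => ⟨e.symm⟩, fun ⟨e⟩ ⟨f⟩ => ⟨e.trans f⟩⟩

variable (R) in
/-- Isomorphism classes of finitely generated nonprojective indecomposable modules. -/
def StabClass : Type 1 := _root_.Quotient (stabSetoid R)

/-- The isomorphism class of a module. -/
def StabObj.cls (M : StabObj R) : StabClass R := Quotient.mk (stabSetoid R) M

theorem StabObj.cls_eq {M N : StabObj R} : M.cls = N.cls ↔ Nonempty (M.1 ≃ₗ[R] N.1) :=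
  Quotient.eq (r := stabSetoid R)

theorem StabObj.cls_surjective : Function.Surjective (StabObj.cls (R := R)) :=
  Quotient.mk_surjective

theorem Syz.of_equiv {M M' N N' : ModuleCat.{0} R} (h : Syz M N) (e : M ≃ₗ[R] M')
    (f : N ≃ₗ[R] N') : Syz M' N' := by
  obtain ⟨P, i, p, hP, hP', hip, hi⟩ := h
  refine ⟨P, i ∘ₗ e.symm, f ∘ₗ p, hP, hP', ⟨hip.inj.comp e.symm.injective,
    f.surjective.comp hip.surj, fun x => ?_⟩, fun x => hi _⟩
  constructor
  · intro hx
    obtain ⟨y, rfl⟩ := (hip.exact x).mp (f.injective (hx.trans (map_zero f).symm))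
    exact ⟨e y, by simp⟩
  · rintro ⟨y, rfl⟩
    simp [hip.p_i]

variable [QuasiFrobenius R]

theorem Stab.exists_syz {N : ModuleCat.{0} R} (hN : Stab R N) :
    ∃ M : ModuleCat.{0} R, Stab R M ∧ Syz M N := by
  have := hN.finite
  obtain ⟨P, _, _, p, hP, hP', hp, hr⟩ := exists_cover (R := R) N
  have hi : ∀ x, (LinearMap.ker p).subtype x ∈ radMod R P := fun x => hr x.2
  exact ⟨.of R (LinearMap.ker p), (isSES_ker hp).stab_left hi hN, .of R P,
    (LinearMap.ker p).subtype, p, hP, hP', isSES_ker hp, hi⟩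

theorem Syz.equiv_left {M M' N : ModuleCat.{0} R} (h : Syz M N) (h' : Syz M' N) (hM : Stab R M)
    (hM' : Stab R M') : Nonempty (M ≃ₗ[R] M') := by
  obtain ⟨P, i, p, hP, hP', hip, hi⟩ := h
  obtain ⟨Q, j, q, hQ, hQ', hjq, hj⟩ := h'
  exact hM.equiv_of_retract_prod hM' (hip.retract_left hjq)

theorem Syz.equiv_right {M N N' : ModuleCat.{0} R} (h : Syz M N) (h' : Syz M N') (hN : Stab R N)
    (hN' : Stab R N') : Nonempty (N ≃ₗ[R] N') := by
  obtain ⟨P, i, p, hP, hP', hip, hi⟩ := h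
  obtain ⟨Q, j, q, hQ, hQ', hjq, hj⟩ := h'
  exact hN.equiv_of_retract_prod hN' (hip.retract_right hjq)

theorem Stab.exists_cosyz {M : ModuleCat.{0} R} (hM : Stab R M) :
    ∃ N : ModuleCat.{0} R, Stab R N ∧ Syz M N := by
  have := hM.finite
  obtain ⟨n, i, hi⟩ := QuasiFrobenius.embed (R := R) M
  have hr : ModRetract R M (LinearMap.ker (LinearMap.range i).mkQ) := by
    rw [Submodule.ker_mkQ]
    exact .of_equiv (LinearEquiv.ofInjective i hi)
  obtain ⟨X, _, _, Q, _, _, q, hX, hQ, hQ', hq, hMq⟩ :=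
    hM.exists_cosyzygy_of_retract (Submodule.mkQ_surjective _) hr
  obtain ⟨K, hK, hKX⟩ := Stab.exists_syz (N := .of R X) hX
  refine ⟨.of R X, hX, ?_⟩
  have hKX' := hKX
  obtain ⟨P, j, p, hP, hP', hjp, hj⟩ := hKX
  obtain ⟨e⟩ := hM.equiv_of_retract_prod (P := P × Q) hK (by
    obtain ⟨a, b, hab⟩ := hMq
    obtain ⟨c, d, hcd⟩ := (isSES_ker hq).retract_left hjp
    refine ⟨(LinearMap.id.prodMap (LinearMap.inr R P Q)) ∘ₗ c ∘ₗ a,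
      b ∘ₗ d ∘ₗ LinearMap.id.prodMap (LinearMap.snd R P Q), ?_⟩
    refine LinearMap.ext fun x => ?_
    refine Eq.trans ?_ (LinearMap.congr_fun hab x)
    exact congrArg b (LinearMap.congr_fun hcd (a x)))
  exact hKX'.of_equiv e.symm (LinearEquiv.refl R _)

variable (R) in
/-- Cosyzygies permute the isomorphism classes of nonprojective indecomposable modules. -/
theorem exists_cosyzygy_perm : ∃ σ : Equiv.Perm (StabClass R),
    ∀ M N : StabObj R, Syz M.1 N.1 ↔ σ M.cls = N.cls := by
  let r : StabClass R → StabClass R → Prop := fun a b =>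
    ∃ M N : StabObj R, M.cls = a ∧ N.cls = b ∧ Syz M.1 N.1
  have hr : ∀ M N : StabObj R, r M.cls N.cls ↔ Syz M.1 N.1 := by
    refine fun M N => ⟨?_, fun h => ⟨M, N, rfl, rfl, h⟩⟩
    rintro ⟨M', N', hM, hN, h⟩
    obtain ⟨e⟩ := StabObj.cls_eq.mp hM
    obtain ⟨f⟩ := StabObj.cls_eq.mp hN
    exact h.of_equiv e f
  have h₁ : ∀ a, ∃ b, r a b := fun a => by
    obtain ⟨M, rfl⟩ := StabObj.cls_surjective a
    obtain ⟨N, hN, h⟩ := M.2.exists_cosyz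
    exact ⟨StabObj.cls ⟨N, hN⟩, M, ⟨N, hN⟩, rfl, rfl, h⟩
  choose s hs using h₁
  have hs' : ∀ a b, r a b → s a = b := by
    intro a b hab
    obtain ⟨M, rfl⟩ := StabObj.cls_surjective a
    obtain ⟨N, rfl⟩ := StabObj.cls_surjective b
    obtain ⟨N', hN'⟩ := StabObj.cls_surjective (s M.cls)
    have := hs M.cls
    rw [← hN'] at this ⊢
    exact StabObj.cls_eq.mpr (((hr _ _).mp this).equiv_right ((hr _ _).mp hab) N'.2 N.2)
  refine ⟨Equiv.ofBijective s ⟨fun a a' haa => ?_, fun b => ?_⟩, fun M N => ?_⟩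
  · obtain ⟨M, rfl⟩ := StabObj.cls_surjective a
    obtain ⟨M', rfl⟩ := StabObj.cls_surjective a'
    obtain ⟨N, hN⟩ := StabObj.cls_surjective (s M.cls)
    have h := hs M.cls
    have h' := hs M'.cls
    rw [← haa] at h'
    rw [← hN] at h h'
    exact StabObj.cls_eq.mpr (((hr _ _).mp h).equiv_left ((hr _ _).mp h') M.2 M'.2)
  · obtain ⟨N, rfl⟩ := StabObj.cls_surjective b
    obtain ⟨M, hM, h⟩ := N.2.exists_syz
    exact ⟨StabObj.cls ⟨M, hM⟩, hs' _ _ ((hr ⟨M, hM⟩ N).mpr h)⟩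
  · rw [← hr]
    refine ⟨fun h => hs' _ _ h, fun h => ?_⟩
    have := hs M.cls
    rwa [show s M.cls = N.cls from h] at this

end StableClasses

/-! ### Two-coloured rings -/

/-- A decomposition `1 = ε true + ε false` of a ring into two idempotents with the properties of
the bipartition of the vertices in the trivial extension of a radical square zero tree algebra. -/
structure TwoColoured (R : Type) [Ring R] (ε : Bool → R) : Prop where
  add : ε true + ε false = 1
  mul : ∀ c, ε c * ε (!c) = 0
  off : ∀ c r, ε c * r * ε (!c) ∈ Ring.jacobson R
  rad_mul : ∀ c, ∀ x ∈ Ring.jacobson R, ∀ y ∈ Ring.jacobson R, x * (ε c * y * ε c) = 0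
  mul_rad : ∀ c, ∀ x ∈ Ring.jacobson R, ∀ y ∈ Ring.jacobson R, (ε c * x * ε c) * y = 0
  socle : ∀ c r, (∀ x ∈ Ring.jacobson R, x * (ε (!c) * r * ε c) = 0) → ε (!c) * r * ε c = 0

section Colours

variable {M N P : Type} [AddCommGroup M] [Module R M] [AddCommGroup N] [Module R N]
  [AddCommGroup P] [Module R P] {ε : Bool → R} {c : Bool}

/-- The top of `N` is concentrated in the colour `c` and the radical in the opposite one. -/
structure Col (ε : Bool → R) (c : Bool) (N : Type) [AddCommGroup N] [Module R N] : Prop where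
  top : ∀ n : N, ε (!c) • n ∈ radMod R N
  rad_smul : ∀ x ∈ Ring.jacobson R, ∀ n : N, x • ε (!c) • n = 0
  smul_rad : ∀ x ∈ Ring.jacobson R, ∀ n : N, ε c • x • n = 0

theorem TwoColoured.add_not (h : TwoColoured R ε) (c : Bool) : ε c + ε (!c) = 1 := by
  cases c
  · rw [add_comm]
    exact h.add
  · exact h.add

theorem TwoColoured.decomp (h : TwoColoured R ε) (c : Bool) (n : N) :
    ε c • n + ε (!c) • n = n := by
  rw [← add_smul, h.add_not, one_smul]

theorem TwoColoured.not_mul (h : TwoColoured R ε) (c : Bool) : ε (!c) * ε c = 0 := by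
  simpa using h.mul (!c)

theorem TwoColoured.idem (h : TwoColoured R ε) (c : Bool) : ε c * ε c = ε c := by
  have := congrArg (ε c * ·) (h.add_not c)
  simpa [mul_add, h.mul] using this

theorem TwoColoured.not_off (h : TwoColoured R ε) (c : Bool) (r : R) :
    ε (!c) * r * ε c ∈ Ring.jacobson R := by
  simpa using h.off (!c) r

theorem Col.of_surjective (h : Col ε c M) {f : M →ₗ[R] N} (hf : Function.Surjective f) :
    Col ε c N := by
  refine ⟨fun n => ?_, fun x hx n => ?_, fun x hx n => ?_⟩ <;> obtain ⟨n, rfl⟩ := hf n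
  · rw [← map_smul]
    exact map_mem_radMod f (h.top n)
  · rw [← map_smul, ← map_smul, h.rad_smul x hx, map_zero]
  · rw [← map_smul, ← map_smul, h.smul_rad x hx, map_zero]

theorem TwoColoured.subsingleton (hε : TwoColoured R ε) [Module.Finite R N] (h : Col ε c N)
    (h' : Col ε (!c) N) : Subsingleton N := by
  refine subsingleton_of_radMod_eq_top (R := R) (eq_top_iff.mpr fun n _ => ?_)
  rw [← hε.decomp c n]
  exact add_mem (by simpa using h'.top n) (h.top n)

theorem Indec.eq_bot_or_eq_bot (h : Indec R N) {A B : Submodule R N} (hAB : IsCompl A B) :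
    A = ⊥ ∨ B = ⊥ := by
  rcases h.2 _ (Submodule.isIdempotentElem_projection hAB) with h0 | h0
  · left
    refine (Submodule.eq_bot_iff _).mpr fun x hx => ?_
    have := LinearMap.congr_fun h0 x
    rwa [Submodule.projection_apply_of_mem_left hAB hx] at this
  · right
    refine (Submodule.eq_bot_iff _).mpr fun x hx => ?_
    have := LinearMap.congr_fun h0 x
    rw [(Submodule.projection_apply_eq_zero_iff hAB).mpr hx] at this
    exact this.symm

theorem Indec.isSimpleModule (h : Indec R N) [IsSemisimpleModule R N] : IsSimpleModule R N := by
  have := h.1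
  have : IsSimpleOrder (Submodule R N) := ⟨fun A => by
    obtain ⟨B, hAB⟩ := exists_isCompl A
    rcases h.eq_bot_or_eq_bot hAB with h0 | h0
    · exact Or.inl h0
    · exact Or.inr (eq_top_of_isCompl_bot (h0 ▸ hAB))⟩
  exact isSimpleModule_iff R N |>.mpr this

theorem Indec.isSimpleModule_of_rad [IsArtinianRing R] (h : Indec R N)
    (h0 : ∀ x ∈ Ring.jacobson R, ∀ n : N, x • n = 0) : IsSimpleModule R N :=
  have : IsSemisimpleModule R N := isSemisimpleModule_of_radMod_eq_bot
    (le_bot_iff.mp (radMod_le.mpr h0))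
  h.isSimpleModule

theorem radMod_eq_bot [IsSimpleModule R N] : radMod R N = ⊥ :=
  le_bot_iff.mp (radMod_le.mpr fun _ hx n => Module.mem_annihilator.mp
    (IsSemisimpleModule.jacobson_le_annihilator R N hx) n)

theorem smul_eq_zero_of_simple [IsSimpleModule R N] {x : R} (hx : x ∈ Ring.jacobson R) (n : N) :
    x • n = 0 :=
  (Submodule.mem_bot R).mp (radMod_eq_bot (R := R) (N := N) ▸ smul_mem_radMod hx n)

theorem radMod_induction {p : N → Prop} {n : N} (hn : n ∈ radMod R N)
    (smul : ∀ x ∈ Ring.jacobson R, ∀ m : N, p (x • m)) (hadd : ∀ m m', p m → p m' → p (m + m')) :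
    p n :=
  Submodule.smul_induction_on hn (fun x hx m _ => smul x hx m) hadd

theorem smul_radMod_eq_zero {z : R} (hz : ∀ y ∈ Ring.jacobson R, ∀ m : N, z • y • m = 0) {n : N}
    (hn : n ∈ radMod R N) : z • n = 0 :=
  radMod_induction (p := fun m => z • m = 0) hn hz fun m m' hm hm' => by
    rw [smul_add, hm, hm', add_zero]

theorem TwoColoured.smul_smul_eq_zero (hε : TwoColoured R ε)
    (h : ∀ c, ∀ x ∈ Ring.jacobson R, ∀ n : N, ε c • x • ε c • n = 0) {x y : R}
    (hx : x ∈ Ring.jacobson R) (hy : y ∈ Ring.jacobson R) (n : N) : x • y • n = 0 := by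
  have key : ∀ c, y • ε c • n = ε (!c) • y • ε c • n := fun c => by
    conv_lhs => rw [← hε.decomp c (y • ε c • n), h c y hy, zero_add]
  have key' : ∀ c (m : N), x • ε c • m = ε (!c) • x • ε c • m := fun c m => by
    conv_lhs => rw [← hε.decomp c (x • ε c • m), h c x hx, zero_add]
  have key'' : ∀ c, x • y • ε c • n = 0 := fun c => by
    have h1 : x * ε (!c) * y ∈ Ring.jacobson R := Ideal.mul_mem_left _ _ hy
    have h2 := h c _ h1 n
    rw [key, key']
    simpa [mul_smul] using h2
  rw [← hε.decomp true n, smul_add, smul_add, key'', key'', add_zero]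

/-- The elements whose component of colour `!c` lies in the radical. -/
def TwoColoured.above (hε : TwoColoured R ε) (c : Bool) (N : Type) [AddCommGroup N] [Module R N] :
    Submodule R N where
  carrier := {n | ε (!c) • n ∈ radMod R N}
  zero_mem' := by
    change ε (!c) • (0 : N) ∈ radMod R N
    rw [smul_zero]
    exact zero_mem _
  add_mem' {a b} ha hb := by
    change ε (!c) • (a + b) ∈ radMod R N
    rw [smul_add]
    exact add_mem ha hb
  smul_mem' r n hn := by
    change ε (!c) • r • n ∈ radMod R N
    rw [← hε.decomp c n, smul_add, smul_add]
    refine add_mem ?_ (Submodule.smul_mem _ _ (Submodule.smul_mem _ _ hn))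
    have := smul_mem_radMod (hε.not_off c r) n
    rwa [mul_smul, mul_smul] at this

/-- The elements of the radical whose component of colour `!c` vanishes. -/
def TwoColoured.below (hε : TwoColoured R ε) (c : Bool)
    (h : ∀ x ∈ Ring.jacobson R, ∀ n ∈ radMod R N, x • n = 0) : Submodule R N where
  carrier := {n | n ∈ radMod R N ∧ ε (!c) • n = 0}
  zero_mem' := ⟨zero_mem _, smul_zero _⟩
  add_mem' {a b} ha hb := ⟨add_mem ha.1 hb.1, by rw [smul_add, ha.2, hb.2, add_zero]⟩
  smul_mem' r n hn := by
    refine ⟨Submodule.smul_mem _ _ hn.1, ?_⟩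
    have h1 := h _ (hε.not_off c r) n hn.1
    rw [mul_smul, mul_smul] at h1
    rw [← hε.decomp c n, hn.2, add_zero, h1]

theorem TwoColoured.exists_part [IsArtinianRing R] (hε : TwoColoured R ε) (c : Bool)
    (h : ∀ c, ∀ x ∈ Ring.jacobson R, ∀ n : N, ε c • x • ε c • n = 0)
    (hJ : ∀ x ∈ Ring.jacobson R, ∀ n ∈ radMod R N, x • n = 0) :
    ∃ A : Submodule R N, A ⊔ radMod R N = hε.above c N ∧ A ⊓ radMod R N = hε.below (!c) hJ := by
  let V := hε.above c N
  have hUV : hε.below (!c) hJ ≤ V := fun n hn => Submodule.smul_mem _ _ hn.1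
  have hJV : radMod R N ≤ V := fun n hn => Submodule.smul_mem _ _ hn
  obtain ⟨A, hA, hA', hA''⟩ := exists_complement_above (R := R) (M := V)
    (U := (hε.below (!c) hJ).comap V.subtype) (W := (radMod R N).comap V.subtype)
    (radMod_le.mpr fun x hx n => by
      refine ⟨smul_mem_radMod hx _, ?_⟩
      rw [Bool.not_not]
      change ε c • x • (n : N) = 0
      rw [← hε.decomp c (n : N), smul_add, smul_add, h c x hx, hJ x hx _ n.2, smul_zero, add_zero])
    (Submodule.comap_mono fun n hn => hn.1)
  refine ⟨A.map V.subtype, ?_, ?_⟩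
  · have := congrArg (Submodule.map V.subtype) hA'
    rwa [Submodule.map_sup, Submodule.map_comap_subtype, inf_eq_right.mpr hJV,
      Submodule.map_subtype_top] at this
  · have := congrArg (Submodule.map V.subtype) hA''
    rw [Submodule.map_comap_subtype, inf_eq_right.mpr hUV] at this
    rw [← this]
    ext y
    constructor
    · rintro ⟨⟨z, hz, rfl⟩, hy⟩
      exact ⟨z, ⟨hz, hy⟩, rfl⟩
    · rintro ⟨z, ⟨hz, hy⟩, rfl⟩
      exact ⟨⟨z, hz, rfl⟩, hy⟩

theorem TwoColoured.exists_col [IsArtinianRing R] (hε : TwoColoured R ε) (hN : Indec R N)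
    (h : ∀ c, ∀ x ∈ Ring.jacobson R, ∀ n : N, ε c • x • ε c • n = 0) : ∃ c, Col ε c N := by
  have hJJ := fun x hx y hy => hε.smul_smul_eq_zero h (x := x) (y := y) hx hy
  have hJ : ∀ x ∈ Ring.jacobson R, ∀ n ∈ radMod R N, x • n = 0 := fun x hx n hn =>
    smul_radMod_eq_zero (fun y hy m => hJJ x hx y hy m) hn
  obtain ⟨A, hA, hA'⟩ := hε.exists_part true h hJ
  obtain ⟨B, hB, hB'⟩ := hε.exists_part false h hJ
  have hcol : ∀ c (A : Submodule R N), A = ⊤ → A ⊔ radMod R N = hε.above c N →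
      A ⊓ radMod R N = hε.below (!c) hJ → Col ε c N := by
    rintro c A rfl hA hA'
    have htop : ∀ n : N, ε (!c) • n ∈ radMod R N := fun n => by
      have : n ∈ hε.above c N := hA ▸ Submodule.mem_sup_left trivial
      exact this
    refine ⟨htop, fun x hx n => hJ x hx _ (htop n), fun x hx n => ?_⟩
    have : x • n ∈ hε.below (!c) hJ := hA' ▸ ⟨trivial, smul_mem_radMod hx n⟩
    simpa using this.2
  have hle : radMod R N ≤ A ⊔ B := fun n hn => by
    rw [← hε.decomp true n]
    have hm : ∀ c, ε c • n ∈ hε.below c hJ := fun c => by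
      refine ⟨Submodule.smul_mem _ _ hn, ?_⟩
      rw [← mul_smul, hε.not_mul, zero_smul]
    refine add_mem (Submodule.mem_sup_right ?_) (Submodule.mem_sup_left ?_)
    · exact (hB' ▸ hm true : ε true • n ∈ B ⊓ radMod R N).1
    · exact (hA' ▸ hm false : ε false • n ∈ A ⊓ radMod R N).1
  have hAB : IsCompl A B := by
    refine IsCompl.of_eq ((Submodule.eq_bot_iff _).mpr fun n hn => ?_)
      (eq_top_iff.mpr fun n _ => ?_)
    · have h1 : n ∈ hε.above true N := hA ▸ Submodule.mem_sup_left hn.1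
      have h2 : n ∈ hε.above false N := hB ▸ Submodule.mem_sup_left hn.2
      have hn' : n ∈ radMod R N := by
        rw [← hε.decomp true n]
        exact add_mem h2 h1
      have h3 : n ∈ hε.below false hJ := hA' ▸ ⟨hn.1, hn'⟩
      have h4 : n ∈ hε.below true hJ := hB' ▸ ⟨hn.2, hn'⟩
      rw [← hε.decomp true n]
      have h5 := h3.2
      rw [Bool.not_false] at h5
      rw [h5, h4.2, add_zero]
    · have hm : ∀ c, ε c • n ∈ hε.above c N := fun c => by
        change ε (!c) • ε c • n ∈ radMod R N
        rw [← mul_smul, hε.not_mul, zero_smul]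
        exact zero_mem _
      rw [← hε.decomp true n]
      refine add_mem ?_ ?_
      · exact sup_le le_sup_left hle (hA ▸ hm true : ε true • n ∈ A ⊔ radMod R N)
      · exact sup_le le_sup_right hle (hB ▸ hm false : ε false • n ∈ B ⊔ radMod R N)
  rcases hN.eq_bot_or_eq_bot hAB with h0 | h0
  · exact ⟨false, hcol false B (eq_top_of_bot_isCompl (h0 ▸ hAB)) hB hB'⟩
  · exact ⟨true, hcol true A (eq_top_of_isCompl_bot (h0 ▸ hAB)) hA hA'⟩

end Colours

/-! ### A combinatorial finiteness argument -/

section Combinatorics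

theorem exists_pow_eq_of_return {Q : Type*} (σ : Equiv.Perm Q) {S : Set Q} (hS : S.Finite)
    (h : ∀ s ∈ S, ∃ k, 0 < k ∧ (σ ^ k) s ∈ S) {s : Q} (hs : s ∈ S) :
    ∃ k, 0 < k ∧ (σ ^ k) s = s := by
  have hinf : {n : ℕ | (σ ^ n) s ∈ S}.Infinite := by
    refine Set.infinite_of_not_bddAbove fun ⟨b, hb⟩ => ?_
    have key : ∀ b, ∃ n, b ≤ n ∧ (σ ^ n) s ∈ S := fun b => by
      induction b with
      | zero => exact ⟨0, le_rfl, hs⟩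
      | succ b ih =>
        obtain ⟨n, hn, hns⟩ := ih
        obtain ⟨k, hk, hks⟩ := h _ hns
        refine ⟨k + n, by omega, ?_⟩
        rwa [pow_add]
    obtain ⟨n, hn, hns⟩ := key (b + 1)
    have := hb hns
    omega
  obtain ⟨m, -, n, -, hne, hmn⟩ :=
    hinf.exists_ne_map_eq_of_mapsTo (f := fun n => (σ ^ n) s) (fun n hn => hn) hS
  have key : ∀ m n, m < n → (σ ^ m) s = (σ ^ n) s → ∃ k, 0 < k ∧ (σ ^ k) s = s := by
    intro m n hlt heq
    refine ⟨n - m, by omega, (σ ^ m).injective ?_⟩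
    rw [← Equiv.Perm.mul_apply, ← pow_add, Nat.add_sub_cancel' hlt.le, heq]
  rcases lt_or_gt_of_ne hne with hlt | hlt
  · exact key m n hlt hmn
  · exact key n m hlt hmn.symm

/-- An abstract stable module category with a shift `σ`, whose objects carry a colour that changes
under the shift except at simple objects, is finite if it has finitely many simple and finitely
many rigid objects. -/
theorem finite_of_coloured_perm {Q : Type*} (σ : Equiv.Perm Q) {S T : Set Q} (hS : S.Finite)
    (hT : T.Finite) (col : Q → Bool) (Z : Q → Q → Prop)
    (shift : ∀ x y, Z x y → Z (σ x) (σ y))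
    (col_shift : ∀ x ∉ S, col (σ x) = !col x)
    (col_shift_simple : ∀ x ∈ S, col (σ x) = col x)
    (zero_of_simple : ∀ s ∈ S, ∀ y ∉ S, col s = col y → Z s y)
    (zero_to_simple : ∀ v, ∀ s ∈ S, col v ≠ col s → Z v s)
    (rigid : ∀ x, col (σ x) = !col x → Z x (σ x) → σ x ∈ T)
    (top : ∀ v, ∃ s ∈ S, col s = col v ∧ ¬ Z v s) : Finite Q := by
  have hret : ∀ s ∈ S, ∃ k, 0 < k ∧ (σ ^ k) s ∈ S := by
    intro s hs
    by_contra! hns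
    have hmem : ∀ k, (σ ^ (k + 2)) s ∈ T := by
      have hZ : ∀ k, Z ((σ ^ k) s) ((σ ^ (k + 1)) s) := fun k => by
        induction k with
        | zero =>
          refine zero_of_simple s hs _ (hns 1 one_pos) ?_
          rw [zero_add, pow_one, col_shift_simple s hs]
        | succ k ih =>
          have := shift _ _ ih
          rwa [← Equiv.Perm.mul_apply, ← Equiv.Perm.mul_apply, ← pow_succ', ← pow_succ'] at this
      intro k
      have h1 := hZ (k + 1)
      rw [pow_succ' σ (k + 1), Equiv.Perm.mul_apply] at h1 ⊢
      exact rigid _ (col_shift _ (hns _ k.succ_pos)) h1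
    have hinj : Function.Injective fun k => (σ ^ (k + 2)) s := by
      have key : ∀ m n, m < n → (σ ^ m) s ≠ (σ ^ n) s := fun m n hlt heq => by
        refine hns (n - m) (by omega) ?_
        have : (σ ^ (n - m)) s = s := (σ ^ m).injective (by
          rw [← Equiv.Perm.mul_apply, ← pow_add, Nat.add_sub_cancel' hlt.le, heq])
        rwa [this]
      intro m n hmn
      by_contra hne
      rcases lt_or_gt_of_ne hne with hlt | hlt
      · exact key _ _ (by omega) hmn
      · exact key _ _ (by omega) hmn.symm
    exact Set.infinite_of_injective_forall_mem hinj hmem hT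
  have hper := fun s hs => exists_pow_eq_of_return σ hS hret (s := s) hs
  have hcov : ∀ v, ∃ s ∈ S, ∃ j : ℕ, (σ ^ j) s = v := by
    intro v
    by_contra! hv
    have hns : ∀ j, ((σ⁻¹) ^ j) v ∉ S := fun j hj => hv _ hj j (by
      rw [← Equiv.Perm.mul_apply, inv_pow, mul_inv_cancel, Equiv.Perm.one_apply])
    obtain ⟨s, hs, hcol, hz⟩ := top v
    have hex : ∃ k, ((σ⁻¹) ^ (k + 1)) s ∈ S := by
      obtain ⟨k, hk, hks⟩ := hper s hs
      obtain ⟨k, rfl⟩ := Nat.exists_eq_succ_of_ne_zero hk.ne'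
      refine ⟨k, ?_⟩
      have : ((σ⁻¹) ^ (k + 1)) s = s := by
        rw [inv_pow, Equiv.Perm.inv_eq_iff_eq, hks]
      rwa [this]
    classical
    obtain ⟨k, hk, hmin⟩ : ∃ k, ((σ⁻¹) ^ (k + 1)) s ∈ S ∧ ∀ j < k, ((σ⁻¹) ^ (j + 1)) s ∉ S :=
      ⟨Nat.find hex, Nat.find_spec hex, fun j hj => Nat.find_min hex hj⟩
    have hstep : ∀ j x, σ (((σ⁻¹) ^ (j + 1)) x) = ((σ⁻¹) ^ j) x := fun j x => by
      rw [pow_succ', Equiv.Perm.mul_apply]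
      exact σ.apply_symm_apply _
    have hcol' : ∀ j ≤ k, col (((σ⁻¹) ^ j) v) = col (((σ⁻¹) ^ j) s) := by
      intro j hj
      induction j with
      | zero => exact hcol.symm
      | succ j ih =>
        have h1 := col_shift _ (hns (j + 1))
        have h2 := col_shift _ (hmin j (by omega))
        rw [hstep, ih (by omega)] at h1
        rw [hstep] at h2
        exact Bool.not_inj (h1.symm.trans h2)
    have hne : col (((σ⁻¹) ^ (k + 1)) v) ≠ col (((σ⁻¹) ^ (k + 1)) s) := by
      have h1 := col_shift _ (hns (k + 1))
      have h2 := col_shift_simple _ hk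
      rw [hstep] at h1 h2
      rw [← h2, ← hcol' k le_rfl, h1]
      exact (Bool.not_ne_self _).symm
    have hback : ∀ j, Z (((σ⁻¹) ^ j) v) (((σ⁻¹) ^ j) s) → Z v s := fun j => by
      induction j with
      | zero => exact id
      | succ j ih =>
        intro h
        have := shift _ _ h
        rw [hstep, hstep] at this
        exact ih this
    exact hz (hback _ (zero_to_simple _ _ hk hne))
  have hfin : (⋃ s ∈ S, {v | ∃ j : ℕ, (σ ^ j) s = v}).Finite := by
    refine hS.biUnion fun s hs => ?_
    obtain ⟨k, hk, hks⟩ := hper s hs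
    refine ((Set.finite_lt_nat k).image fun j => (σ ^ j) s).subset ?_
    rintro _ ⟨j, rfl⟩
    refine ⟨j % k, Nat.mod_lt _ hk, ?_⟩
    have hm : ∀ m, (σ ^ (k * m)) s = s := fun m => by
      induction m with
      | zero => rfl
      | succ m ih => rw [mul_add, mul_one, pow_add, Equiv.Perm.mul_apply, hks, ih]
    conv_rhs => rw [← Nat.mod_add_div j k, pow_add, Equiv.Perm.mul_apply, hm]
  refine Set.finite_univ_iff.mp (hfin.subset fun v _ => ?_)
  obtain ⟨s, hs, j, hj⟩ := hcov v
  exact Set.mem_biUnion hs ⟨j, hj⟩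

end Combinatorics

/-! ### Colours of nonprojective indecomposable modules -/

section StableColours

variable {M N P Q : Type} [AddCommGroup M] [Module R M] [AddCommGroup N] [Module R N]
  [AddCommGroup P] [Module R P] [AddCommGroup Q] [Module R Q] {ε : Bool → R} {c : Bool}

theorem exists_mem_radMod {f : M →ₗ[R] N} (hf : Function.Surjective f) {n : N}
    (hn : n ∈ radMod R N) : ∃ m ∈ radMod R M, f m = n := by
  refine radMod_induction (p := fun n => ∃ m ∈ radMod R M, f m = n) hn (fun x hx n => ?_) ?_
  · obtain ⟨m, rfl⟩ := hf n
    exact ⟨x • m, smul_mem_radMod hx m, map_smul _ _ _⟩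
  · rintro _ _ ⟨m, hm, rfl⟩ ⟨m', hm', rfl⟩
    exact ⟨m + m', add_mem hm hm', map_add _ _ _⟩

theorem Col.of_equiv (h : Col ε c M) (e : M ≃ₗ[R] N) : Col ε c N :=
  h.of_surjective (f := e.toLinearMap) e.surjective

theorem Col.smul_smul_eq_zero (hε : TwoColoured R ε) (h : Col ε c N) {x y : R}
    (hx : x ∈ Ring.jacobson R) (hy : y ∈ Ring.jacobson R) (n : N) : x • y • n = 0 := by
  rw [← hε.decomp c (y • n), h.smul_rad y hy, zero_add, h.rad_smul x hx]

theorem Col.smul_of_simple (hε : TwoColoured R ε) (h : Col ε c N) [IsSimpleModule R N] (n : N) :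
    ε c • n = n := by
  have h0 := h.top n
  rw [radMod_eq_bot, Submodule.mem_bot] at h0
  conv_rhs => rw [← hε.decomp c n, h0, add_zero]

/-- An indecomposable module whose socle meets its top is simple. -/
theorem Col.isSimpleModule [IsArtinianRing R] (hε : TwoColoured R ε) (h : Col ε c N)
    (hN : Indec R N) {s : N} (hs : s ≠ 0) (hs' : ε c • s = s)
    (hJ : ∀ x ∈ Ring.jacobson R, x • s = 0) : IsSimpleModule R N := by
  have hdisj : ∀ y ∈ Submodule.span R {s}, y ∈ radMod R N → y = 0 := fun y hy hy' => by
    obtain ⟨r, rfl⟩ := Submodule.mem_span_singleton.mp hy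
    have h1 := hJ _ (hε.not_off c r)
    rw [mul_smul, mul_smul, hs'] at h1
    rw [← hε.decomp c (r • s), h1, add_zero]
    exact smul_radMod_eq_zero h.smul_rad hy'
  obtain ⟨A, hA, hA', hA''⟩ := exists_complement_above (R := R) (M := N) le_rfl
    (le_sup_right : radMod R N ≤ Submodule.span R {s} ⊔ radMod R N)
  have hc : IsCompl A (Submodule.span R {s}) := by
    refine IsCompl.of_eq ((Submodule.eq_bot_iff _).mpr fun y hy => ?_) ?_
    · refine hdisj y hy.2 (hA'' ▸ ⟨hy.1, Submodule.mem_sup_left hy.2⟩)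
    · rwa [sup_comm (Submodule.span R {s}), ← sup_assoc, sup_eq_left.mpr hA] at hA'
  rcases hN.eq_bot_or_eq_bot hc with h0 | h0
  · have : IsSemisimpleModule R N :=
      isSemisimpleModule_of_radMod_eq_bot (le_bot_iff.mp (h0 ▸ hA))
    exact hN.isSimpleModule
  · exact absurd (Submodule.span_singleton_eq_bot.mp h0) hs

theorem indec_of_simple [IsSimpleModule R N] : Indec R N := by
  refine ⟨IsSimpleModule.nontrivial R N, fun e he => ?_⟩
  rcases LinearMap.bijective_or_eq_zero e with h | h
  · right
    refine LinearMap.ext fun x => h.1 ?_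
    exact LinearMap.congr_fun he x
  · exact Or.inl h

section Syzygy

variable {i : M →ₗ[R] P} {p : P →ₗ[R] N}

theorem Col.top_of_cover (h : Col ε c N) (hp : Function.Surjective p)
    (hk : LinearMap.ker p ≤ radMod R P) (q : P) : ε (!c) • q ∈ radMod R P := by
  obtain ⟨q', hq', hqq'⟩ := exists_mem_radMod hp (h.top (p q))
  have h1 : ε (!c) • q - q' ∈ radMod R P := hk (by
    rw [LinearMap.mem_ker, map_sub, hqq', map_smul, sub_self])
  simpa using add_mem h1 hq'

theorem span_colour_eq_top [Module.Finite R P] (hε : TwoColoured R ε)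
    (h : ∀ q : P, ε (!c) • q ∈ radMod R P) :
    Submodule.span R (Set.range fun q : P => ε c • q) = ⊤ := by
  refine eq_top_of_sup_radMod (eq_top_iff.mpr fun q _ => ?_)
  rw [← hε.decomp c q]
  exact add_mem (Submodule.mem_sup_left (Submodule.subset_span ⟨q, rfl⟩))
    (Submodule.mem_sup_right (h q))

theorem TwoColoured.rad_smul_smul (hε : TwoColoured R ε) (c : Bool) {x y : R}
    (hx : x ∈ Ring.jacobson R) (hy : y ∈ Ring.jacobson R) (n : N) :
    x • ε c • y • ε c • n = 0 := by
  have := congrArg (· • n) (hε.rad_mul c x hx y hy)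
  simpa [mul_smul] using this

theorem TwoColoured.smul_smul_rad (hε : TwoColoured R ε) (c : Bool) {x y : R}
    (hx : x ∈ Ring.jacobson R) (hy : y ∈ Ring.jacobson R) (n : N) :
    ε c • x • ε c • y • n = 0 := by
  have := congrArg (· • n) (hε.mul_rad c x hx y hy)
  simpa [mul_smul] using this

theorem TwoColoured.smul_rad_eq_zero (hε : TwoColoured R ε)
    (h : ∀ q : P, ε (!c) • q ∈ radMod R P) {z : R}
    (h1 : ∀ y ∈ Ring.jacobson R, ∀ q : P, z • y • ε c • q = 0)
    (h2 : ∀ y ∈ Ring.jacobson R, ∀ y' ∈ Ring.jacobson R, ∀ q : P,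
      z • y • ε (!c) • y' • ε c • q = 0) {q : P} (hq : q ∈ radMod R P) : z • q = 0 := by
  refine smul_radMod_eq_zero (fun y hy q => ?_) hq
  rw [← hε.decomp c q, smul_add, smul_add, h1 y hy, zero_add]
  have h3 : (z * y * ε (!c)) • ε (!c) • q = 0 := by
    refine smul_radMod_eq_zero (fun y' hy' q => ?_) (h q)
    rw [mul_smul, mul_smul, ← hε.decomp c q, smul_add, smul_add, smul_add, smul_add,
      h2 y hy y' hy', hε.rad_smul_smul (!c) hy hy', smul_zero, add_zero]
  rwa [mul_smul, mul_smul, ← mul_smul (ε (!c)), hε.idem] at h3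

theorem TwoColoured.rad_smul_of_rad (hε : TwoColoured R ε)
    (h : ∀ q : P, ε (!c) • q ∈ radMod R P) {x : R} (hx : x ∈ Ring.jacobson R) {q : P}
    (hq : q ∈ radMod R P) : x • ε c • q = 0 := by
  rw [← mul_smul]
  refine hε.smul_rad_eq_zero h (fun y hy q => ?_) (fun y hy y' hy' q => ?_) hq
  · rw [mul_smul, hε.rad_smul_smul c hx hy]
  · have : y * ε (!c) * y' ∈ Ring.jacobson R := Ideal.mul_mem_left _ _ hy'
    have := hε.rad_smul_smul c hx this q
    rw [mul_smul]
    simpa [mul_smul] using this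

theorem TwoColoured.eq_zero_of_socle (hε : TwoColoured R ε) [Module.Finite R P]
    [Module.Projective R P] (h : ∀ q : P, ε (!c) • q ∈ radMod R P) {q : P}
    (hq : ε (!c) • q = q) (hJ : ∀ x ∈ Ring.jacobson R, x • q = 0) : q = 0 := by
  have hsurj : Function.Surjective (Finsupp.linearCombination R fun q : P => ε c • q) := by
    rw [← LinearMap.range_eq_top, Finsupp.range_linearCombination, span_colour_eq_top hε h]
  obtain ⟨s, hs⟩ := Module.projective_lifting_property _ LinearMap.id hsurj
  have hs := LinearMap.congr_fun hs q
  refine hs.symm.trans ?_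
  rw [LinearMap.comp_apply, Finsupp.linearCombination_apply]
  refine Finset.sum_eq_zero fun a _ => ?_
  have h1 : s q a = ε (!c) * s q a := by
    conv_lhs => rw [← hq, map_smul, Finsupp.smul_apply, smul_eq_mul]
  have h2 : s q a * ε c = 0 := by
    rw [h1]
    refine hε.socle c _ fun x hx => ?_
    rw [← h1, ← mul_assoc, ← smul_eq_mul x, ← Finsupp.smul_apply, ← map_smul, hJ x hx, map_zero,
      Finsupp.zero_apply, zero_mul]
  change s q a • ε c • a = 0
  rw [← mul_smul, h2, zero_smul]

theorem Stab.exists_col [QuasiFrobenius R] (hε : TwoColoured R ε) (hN : Stab R N) :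
    ∃ c, Col ε c N := by
  obtain ⟨X, hX, P, i, p, hP, hP', hip, hi⟩ := Stab.exists_cosyz (M := .of R N) hN
  refine hε.exists_col hN.indec fun c x hx n => hip.inj ?_
  rw [map_smul, map_smul, map_smul, map_zero, ← mul_smul, ← mul_smul]
  refine smul_radMod_eq_zero (fun y hy m => ?_) (hi n)
  rw [mul_smul, mul_smul, hε.smul_smul_rad c hx hy]

theorem Syz.col_not {M N : ModuleCat.{0} R} [IsArtinianRing R] (hε : TwoColoured R ε) (h : Syz M N)
    (hN : Col ε c N) (hM : Indec R M) (hM' : ¬ IsSimpleModule R M) {d : Bool} (hd : Col ε d M) :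
    d = !c := by
  obtain ⟨P, i, p, hP, hP', hip, hi⟩ := h
  have htop := hN.top_of_cover hip.surj fun q hq => by
    obtain ⟨m, rfl⟩ := (hip.exact q).mp hq
    exact hi m
  refine Bool.eq_not.mpr ?_
  rintro rfl
  refine hM' (hM.isSimpleModule_of_rad fun x hx m => ?_)
  rw [← hε.decomp d m, smul_add, hd.rad_smul x hx, add_zero]
  refine hip.inj ?_
  rw [map_smul, map_smul, map_zero, hε.rad_smul_of_rad htop hx (hi m)]

theorem Syz.col_of_simple {M N : ModuleCat.{0} R} (hε : TwoColoured R ε) (h : Syz M N)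
    (hN : Col ε c N) [IsSimpleModule R M] {d : Bool} (hd : Col ε d M) : d = c := by
  obtain ⟨P, i, p, hP, hP', hip, hi⟩ := h
  have htop := hN.top_of_cover hip.surj fun q hq => by
    obtain ⟨m, rfl⟩ := (hip.exact q).mp hq
    exact hi m
  by_contra hdc
  obtain rfl : d = !c := Bool.eq_not.mpr hdc
  have := IsSimpleModule.nontrivial R M
  obtain ⟨m, hm⟩ := exists_ne (0 : M)
  refine hm (hip.inj ?_)
  rw [map_zero]
  refine hε.eq_zero_of_socle htop ?_ fun x hx => ?_
  · rw [← map_smul, hd.smul_of_simple hε]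
  · rw [← map_smul, smul_eq_zero_of_simple hx, map_zero]

theorem FactorsProj.zero : FactorsProj (0 : M →ₗ[R] N) := ⟨0, 0, 0, fun _ => rfl⟩

theorem Col.stabZero_of_simple [IsArtinianRing R] (hε : TwoColoured R ε) (hM : Col ε c M)
    [IsSimpleModule R M] (hN : Col ε c N) (hN' : Indec R N) (hs : ¬ IsSimpleModule R N) :
    StabZero R M N := by
  intro u
  have : u = 0 := by
    by_contra hu
    obtain ⟨m, hm⟩ := DFunLike.ne_iff.mp hu
    refine hs (hN.isSimpleModule hε hN' hm ?_ fun x hx => ?_)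
    · rw [← map_smul, hM.smul_of_simple hε]
    · rw [← map_smul, smul_eq_zero_of_simple hx, map_zero]
  rw [this]
  exact .zero

theorem Col.stabZero_to_simple (hε : TwoColoured R ε) (hM : Col ε (!c) M) (hN : Col ε c N)
    [IsSimpleModule R N] : StabZero R M N := by
  intro u
  have : u = 0 := LinearMap.ext fun m => by
    have h1 := map_mem_radMod u (hM.top m)
    rw [radMod_eq_bot, Submodule.mem_bot, map_smul, Bool.not_not, hN.smul_of_simple hε] at h1
    exact h1
  rw [this]
  exact .zero

theorem Syz.tauRigid [QuasiFrobenius R] {W X Y : ModuleCat.{0} R} (hε : TwoColoured R ε)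
    (h : Syz W X) (h' : Syz X Y) (hX : Col ε c X) (hY : Col ε (!c) Y) (hz : StabZero R X Y) :
    TauRigid R Y := by
  obtain ⟨P, i, p, hP, hP', hip, hi⟩ := h
  obtain ⟨Q, j, q, hQ, hQ', hjq, hj⟩ := h'
  have hk : LinearMap.ker p ≤ radMod R P := fun x hx => by
    obtain ⟨m, rfl⟩ := (hip.exact x).mp hx
    exact hi m
  have htop := hX.top_of_cover hip.surj hk
  refine ⟨⟨P, Q, j ∘ₗ p, q, hP, hQ, hP', hQ', hjq.surj, fun y => ?_⟩, fun u => ?_⟩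
  · rw [hjq.exact y]
    constructor
    · rintro ⟨x, rfl⟩
      obtain ⟨x, rfl⟩ := hip.surj x
      exact ⟨x, rfl⟩
    · rintro ⟨x, rfl⟩
      exact ⟨p x, rfl⟩
  · have hu : ∀ x ∈ radMod R P, u x = 0 := fun x hx => by
      refine (LinearMap.mem_ker).mp (radMod_le.mpr (fun y hy x => ?_) hx)
      have h1 : u (ε (!c) • x) ∈ radMod R Y := map_mem_radMod u (htop x)
      have h2 : y • u (ε (!c) • x) = 0 :=
        smul_radMod_eq_zero (fun y' hy' n => hY.smul_smul_eq_zero hε hy hy' n) h1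
      have h3 := hY.rad_smul y hy (u x)
      rw [Bool.not_not] at h3
      rw [LinearMap.mem_ker, map_smul, ← hε.decomp c x, map_add, smul_add, h2, add_zero, map_smul,
        h3]
    obtain ⟨v, hv⟩ := exists_descend hip.surj u fun x hx => hu x (hk hx)
    obtain ⟨w, hw⟩ := (hz v).extend hjq.inj
    exact ⟨w, fun x => by rw [LinearMap.comp_apply, hw, hv]⟩

theorem Stab.exists_simple_quotient [IsArtinianRing R] (hM : Stab R M) :
    ∃ (S : Type) (_ : AddCommGroup S) (_ : Module R S) (f : M →ₗ[R] S),
      Function.Surjective f ∧ IsSimpleModule R S ∧ Stab R S ∧ ¬ StabZero R M S := by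
  have := hM.finite
  have := hM.indec.1
  obtain ⟨W, hW, -⟩ := (eq_top_or_exists_le_coatom (⊥ : Submodule R M)).resolve_left bot_ne_top
  have hS : IsSimpleModule R (M ⧸ W) := isSimpleModule_iff_isCoatom.mpr hW
  have := IsSimpleModule.nontrivial R (M ⧸ W)
  have hproj : ∀ (P : Type) [AddCommGroup P] [Module R P] [Module.Projective R P] [Nontrivial P]
      (f : M →ₗ[R] P), ¬ Function.Surjective f := fun P _ _ _ _ f hf => by
    obtain ⟨s, hs⟩ := Module.projective_lifting_property f LinearMap.id hf
    obtain ⟨e⟩ := hM.indec.equiv_of_retract ⟨s, f, hs⟩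
    exact hM.not_projective (Module.Projective.of_equiv e)
  refine ⟨M ⧸ W, _, _, W.mkQ, W.mkQ_surjective, hS, ⟨inferInstance, indec_of_simple, fun _ =>
    hproj _ _ W.mkQ_surjective⟩, fun hz => ?_⟩
  obtain ⟨P, _, _, p, hP, hP', hp, hk⟩ := exists_cover (R := R) (M ⧸ W)
  obtain ⟨v, hv⟩ := (hz W.mkQ).lift hp
  have : Nontrivial P := hp.nontrivial
  refine hproj P v (surjective_of_range_sup_radMod (R := R) (eq_top_iff.mpr fun x _ => ?_))
  obtain ⟨m, hm⟩ := W.mkQ_surjective (p x)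
  rw [← sub_add_cancel x (v m)]
  refine add_mem (Submodule.mem_sup_right (hk ?_)) (Submodule.mem_sup_left ⟨m, rfl⟩)
  rw [LinearMap.mem_ker, map_sub, hv, hm, sub_self]

end Syzygy

end StableColours

/-! ### Finiteness of the stable category -/

section Finiteness

theorem FinIso.finite_cls {q : ModuleCat.{0} R → Prop} (h : FinIso q) :
    {a : StabClass R | ∃ M : StabObj R, M.cls = a ∧ q M.1}.Finite := by
  obtain ⟨l, hl⟩ := h
  let F : ModuleCat.{0} R → Set (StabClass R) := fun X =>
    {a | ∃ M : StabObj R, M.cls = a ∧ Nonempty (M.1 ≃ₗ[R] X)}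
  have hF : ∀ X, (F X).Finite := fun X => Set.Subsingleton.finite (by
    rintro _ ⟨M, rfl, ⟨e⟩⟩ _ ⟨N, rfl, ⟨f⟩⟩
    exact StabObj.cls_eq.mpr ⟨e.trans f.symm⟩)
  refine (l.finite_toSet.biUnion fun X _ => hF X).subset ?_
  rintro _ ⟨M, rfl, hM⟩
  obtain ⟨X, hX, e⟩ := hl _ hM
  exact Set.mem_biUnion hX ⟨M, rfl, e⟩

theorem finIso_of_finite_cls (h : Finite (StabClass R)) :
    FinIso fun U : ModuleCat.{0} R => Stab R U := by
  obtain ⟨g, hg⟩ := StabObj.cls_surjective (R := R).hasRightInverse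
  have := Fintype.ofFinite (StabClass R)
  refine ⟨Finset.univ.toList.map fun a => (g a).1, fun U hU => ?_⟩
  refine ⟨_, List.mem_map.mpr ⟨StabObj.cls ⟨U, hU⟩, by simp, rfl⟩, ?_⟩
  exact StabObj.cls_eq.mp (hg (StabObj.cls ⟨U, hU⟩)).symm

theorem finIso_simple [IsArtinianRing R] :
    FinIso fun U : ModuleCat.{0} R => IsSimpleModule R U := by
  refine (finIso_indec_retract (R := R) (R ⧸ Ring.jacobson R)).mono fun U hU => ?_
  have hss : IsSemisimpleModule R (R ⧸ Ring.jacobson R) := by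
    refine isSemisimpleModule_of_radMod_eq_bot (le_bot_iff.mp (radMod_le.mpr fun x hx m => ?_))
    obtain ⟨r, rfl⟩ := Submodule.mkQ_surjective _ m
    rw [← map_smul, Submodule.mem_bot, Submodule.mkQ_apply, Submodule.Quotient.mk_eq_zero]
    exact Ideal.mul_mem_right _ _ hx
  refine ⟨indec_of_simple, ?_⟩
  have := IsSimpleModule.nontrivial R U
  obtain ⟨u, hu⟩ := exists_ne (0 : U)
  obtain ⟨f, hf⟩ := exists_descend (Submodule.mkQ_surjective (Ring.jacobson R))
    (LinearMap.toSpanSingleton R U u) fun x hx =>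
      smul_eq_zero_of_simple ((Submodule.Quotient.mk_eq_zero _).mp hx) u
  have hsurj : Function.Surjective f := fun y => by
    obtain ⟨r, rfl⟩ := IsSimpleModule.toSpanSingleton_surjective R hu y
    exact ⟨_, hf r⟩
  obtain ⟨s, hs⟩ := IsSemisimpleModule.lifting_property f hsurj LinearMap.id
  exact ⟨s, f, hs⟩

theorem finite_stabClass [QuasiFrobenius R] {ε : Bool → R} (hε : TwoColoured R ε)
    (ht : FinIso fun U : ModuleCat.{0} R => Module.Finite R U ∧ Indec R U ∧ TauRigid R U) :
    Finite (StabClass R) := by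
  obtain ⟨σ, hσ⟩ := exists_cosyzygy_perm R
  have hcol : ∀ M : StabObj R, ∃ c, Col ε c M.1 := fun M => M.2.exists_col hε
  have hobj : ∀ a : StabClass R, ∃ M : StabObj R, M.cls = a := fun a => StabObj.cls_surjective a
  choose rep hrep using hobj
  choose col₀ hcol₀ using fun a => hcol (rep a)
  have huniq : ∀ (M : StabObj R) c d, Col ε c M.1 → Col ε d M.1 → c = d := fun M c d hc hd => by
    by_contra hne
    obtain rfl : d = !c := Bool.eq_not.mpr (Ne.symm hne)
    have := M.2.finite
    exact not_subsingleton_iff_nontrivial.mpr M.2.indec.1 (hε.subsingleton hc hd)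
  have hiff : ∀ (M : StabObj R) c, Col ε c M.1 ↔ col₀ M.cls = c := fun M c => by
    obtain ⟨e⟩ := StabObj.cls_eq.mp (hrep M.cls)
    have h := (hcol₀ M.cls).of_equiv e
    exact ⟨fun hc => huniq M _ _ h hc, fun hc => hc ▸ h⟩
  let S : Set (StabClass R) := {a | ∃ M : StabObj R, M.cls = a ∧ IsSimpleModule R M.1}
  let T : Set (StabClass R) := {a | ∃ M : StabObj R, M.cls = a ∧
    (Module.Finite R M.1 ∧ Indec R M.1 ∧ TauRigid R M.1)}
  have hSiff : ∀ M : StabObj R, M.cls ∈ S ↔ IsSimpleModule R M.1 := fun M => by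
    refine ⟨?_, fun h => ⟨M, rfl, h⟩⟩
    rintro ⟨N, hN, h⟩
    obtain ⟨e⟩ := StabObj.cls_eq.mp hN
    exact IsSimpleModule.congr e.symm
  let Z : StabClass R → StabClass R → Prop := fun a b =>
    ∃ M N : StabObj R, M.cls = a ∧ N.cls = b ∧ StabZero R M.1 N.1
  have hZ : ∀ M N : StabObj R, Z M.cls N.cls ↔ StabZero R M.1 N.1 := fun M N => by
    refine ⟨?_, fun h => ⟨M, N, rfl, rfl, h⟩⟩
    rintro ⟨M', N', hM, hN, h⟩
    obtain ⟨e⟩ := StabObj.cls_eq.mp hM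
    obtain ⟨f⟩ := StabObj.cls_eq.mp hN
    exact h.of_equiv e f
  have hsyz : ∀ M : StabObj R, ∃ N : StabObj R, σ M.cls = N.cls ∧ Syz M.1 N.1 := fun M => by
    obtain ⟨N, hN, h⟩ := M.2.exists_cosyz
    exact ⟨⟨N, hN⟩, (hσ M ⟨N, hN⟩).mp h, h⟩
  refine finite_of_coloured_perm σ (S := S) (T := T) finIso_simple.finite_cls ht.finite_cls col₀ Z
    (fun x y h => ?_) (fun x hx => ?_) (fun x hx => ?_) (fun s hs y hy hsy => ?_)
    (fun v s hs hvs => ?_) (fun x hx hxz => ?_) fun v => ?_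
  · obtain ⟨M, rfl⟩ := StabObj.cls_surjective x
    obtain ⟨N, rfl⟩ := StabObj.cls_surjective y
    obtain ⟨M', hM, P, i, p, hP, hP', hip, -⟩ := hsyz M
    obtain ⟨N', hN, Q, j, q, hQ, hQ', hjq, -⟩ := hsyz N
    rw [hM, hN, hZ]
    exact StabZero.shift hip hjq ((hZ M N).mp h)
  · obtain ⟨M, rfl⟩ := StabObj.cls_surjective x
    obtain ⟨N, hN, hMN⟩ := hsyz M
    obtain ⟨c, hc⟩ := hcol N
    obtain ⟨d, hd⟩ := hcol M
    rw [hN, (hiff N c).mp hc, (hiff M d).mp hd,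
      hMN.col_not hε hc M.2.indec (mt (hSiff M).mpr hx) hd, Bool.not_not]
  · obtain ⟨M, rfl⟩ := StabObj.cls_surjective x
    obtain ⟨N, hN, hMN⟩ := hsyz M
    obtain ⟨c, hc⟩ := hcol N
    obtain ⟨d, hd⟩ := hcol M
    have := (hSiff M).mp hx
    rw [hN, (hiff N c).mp hc, (hiff M d).mp hd, hMN.col_of_simple hε hc hd]
  · obtain ⟨M, rfl⟩ := StabObj.cls_surjective s
    obtain ⟨N, rfl⟩ := StabObj.cls_surjective y
    have := (hSiff M).mp hs
    exact (hZ M N).mpr (((hiff M _).mpr hsy).stabZero_of_simple hε ((hiff N _).mpr rfl) N.2.indec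
      (mt (hSiff N).mpr hy))
  · obtain ⟨M, rfl⟩ := StabObj.cls_surjective v
    obtain ⟨N, rfl⟩ := StabObj.cls_surjective s
    have := (hSiff N).mp hs
    exact (hZ M N).mpr (((hiff M _).mpr (Bool.eq_not.mpr hvs)).stabZero_to_simple hε
      ((hiff N _).mpr rfl))
  · obtain ⟨M, rfl⟩ := StabObj.cls_surjective x
    obtain ⟨N, hN, hMN⟩ := hsyz M
    obtain ⟨W, hW⟩ := StabObj.cls_surjective (σ.symm M.cls)
    have hWM : Syz W.1 M.1 := (hσ W M).mpr (by rw [hW, Equiv.apply_symm_apply])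
    rw [hN] at hx hxz ⊢
    exact ⟨N, rfl, N.2.finite, N.2.indec, hWM.tauRigid hε hMN ((hiff M _).mpr rfl)
      ((hiff N _).mpr hx) ((hZ M N).mp hxz)⟩
  · obtain ⟨M, rfl⟩ := StabObj.cls_surjective v
    obtain ⟨S', _, _, f, hf, hsimple, hstab, hne⟩ := M.2.exists_simple_quotient
    let N : StabObj R := ⟨.of R S', hstab⟩
    refine ⟨N.cls, ⟨N, rfl, hsimple⟩, ?_, mt (hZ M N).mp hne⟩
    exact (hiff N _).mp (((hiff M _).mpr rfl).of_surjective hf)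

theorem indec_of_isIndecMod {M : ModuleCat.{0} R} (h : IsIndecMod M) : Indec R M := by
  refine ⟨?_, fun e he => ?_⟩
  · by_contra hM
    rw [not_nontrivial_iff_subsingleton] at hM
    exact h.1 (ModuleCat.isZero_of_subsingleton M)
  · have hc : IsCompl (LinearMap.range e) (LinearMap.ker e) :=
      (LinearMap.IsIdempotentElem.isCompl he)
    let φ := Submodule.prodEquivOfIsCompl _ _ hc
    have hiso : Nonempty (M ≅ ModuleCat.of R (LinearMap.range e) ⊞
        ModuleCat.of R (LinearMap.ker e)) :=
      ⟨φ.symm.toModuleIso ≪≫ (ModuleCat.biprodIsoProd (ModuleCat.of R (LinearMap.range e))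
        (ModuleCat.of R (LinearMap.ker e))).symm⟩
    rcases h.2 _ _ hiso with h0 | h0
    · left
      have := ModuleCat.subsingleton_of_isZero h0
      refine LinearMap.ext fun x => ?_
      exact congrArg Subtype.val (Subsingleton.elim (⟨e x, x, rfl⟩ : LinearMap.range e) 0)
    · right
      have := ModuleCat.subsingleton_of_isZero h0
      refine LinearMap.ext fun x => ?_
      have hx : x - e x ∈ LinearMap.ker e := by
        rw [LinearMap.mem_ker, map_sub, ← Module.End.mul_apply, he, sub_self]
      have := congrArg Subtype.val (Subsingleton.elim (⟨x - e x, hx⟩ : LinearMap.ker e) 0)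
      exact (sub_eq_zero.mp this).symm

/-- A two-coloured quasi-Frobenius algebra which is τ-tilting finite is representation-finite. -/
theorem TwoColoured.isRepFiniteRing (K : Type) [Field K] [Algebra K R] [FiniteDimensional K R]
    [QuasiFrobenius R] {ε : Bool → R} (hε : TwoColoured R ε) (ht : IsTauTiltingFiniteRing R) :
    IsRepFiniteRing R := by
  obtain ⟨l, hl⟩ := (finIso_of_finite_cls (finite_stabClass hε (finIso_indec_tauRigid K ht))).or
    (finIso_indec_retract (R := R) R)
  refine ⟨l.length, fun i => l.get i, fun M hM hM' => ?_⟩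
  have hfin : Module.Finite R M := hM
  have hind := indec_of_isIndecMod hM'
  obtain ⟨X, hX, ⟨e⟩⟩ := hl M (by
    by_cases hp : Module.Projective R M
    · obtain ⟨n, hn⟩ := exists_retract_pow R M
      exact Or.inr ⟨hind, hind.retract_of_inAdd ⟨n, hn⟩⟩
    · exact Or.inl ⟨hfin, hind, hp⟩)
  obtain ⟨i, rfl⟩ := List.get_of_mem hX
  exact ⟨i, ⟨e.toModuleIso⟩⟩

end Finiteness

/-! ### Frobenius algebras are quasi-Frobenius -/

section Frobenius

variable {K : Type} [Field K] [Algebra K R] [FiniteDimensional K R]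

theorem exists_coinduced (φ : R →ₗ[K] K) (hφ : ∀ b, (∀ r, φ (r * b) = 0) → b = 0) {N : Type}
    [AddCommGroup N] [Module R N] [Module K N] [IsScalarTower K R N] (ψ : N →ₗ[K] K) :
    ∃ k : N →ₗ[R] R, ∀ r n, φ (r * k n) = ψ (r • n) := by
  let B : R →ₗ[K] R →ₗ[K] K := ((LinearMap.mul K R).compr₂ φ).flip
  have hB : ∀ b r, B b r = φ (r * b) := fun b r => rfl
  have hinj : Function.Injective B := (injective_iff_map_eq_zero B).mpr fun b hb =>
    hφ b fun r => by rw [← hB, hb, LinearMap.zero_apply]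
  have hsurj : Function.Surjective B :=
    (LinearMap.injective_iff_surjective_of_finrank_eq_finrank
      (Subspace.dual_finrank_eq (K := K) (V := R)).symm).mp hinj
  have hex : ∀ n : N, ∃ b, ∀ r, φ (r * b) = ψ (r • n) := fun n => by
    obtain ⟨b, hb⟩ := hsurj (ψ ∘ₗ (LinearMap.toSpanSingleton R N n).restrictScalars K)
    exact ⟨b, fun r => by rw [← hB, hb]; rfl⟩
  choose k hk using hex
  have huniq : ∀ n b, (∀ r, φ (r * b) = ψ (r • n)) → k n = b := fun n b hb =>
    sub_eq_zero.mp (hφ _ fun r => by rw [mul_sub, map_sub, hk, hb, sub_self])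
  exact ⟨{ toFun := k
           map_add' := fun m n => huniq _ _ fun r => by
            rw [mul_add, map_add, hk, hk, smul_add, map_add]
           map_smul' := fun s n => huniq _ _ fun r => by
            rw [RingHom.id_apply, smul_eq_mul, ← mul_assoc, hk, mul_smul] }, fun r n => hk n r⟩

theorem quasiFrobenius_of_form (φ : R →ₗ[K] K) (hφ : ∀ b, (∀ r, φ (r * b) = 0) → b = 0) :
    QuasiFrobenius R where
  artinian := IsArtinianRing.of_finite K R
  extend {M N} _ _ _ _ i hi h := by
    let _ : Module K M := Module.compHom M (algebraMap K R)
    let _ : Module K N := Module.compHom N (algebraMap K R)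
    have hM : IsScalarTower K R M := IsScalarTower.of_compHom K R M
    have hN : IsScalarTower K R N := IsScalarTower.of_compHom K R N
    obtain ⟨l, hl⟩ := (i.restrictScalars K).exists_leftInverse_of_injective
      (LinearMap.ker_eq_bot.mpr hi)
    obtain ⟨k, hk⟩ := exists_coinduced φ hφ (φ ∘ₗ h.restrictScalars K ∘ₗ l)
    refine ⟨k, fun x => sub_eq_zero.mp (hφ _ fun r => ?_)⟩
    have h1 : l (r • i x) = r • x := by
      rw [← map_smul]
      exact LinearMap.congr_fun hl (r • x)
    rw [mul_sub, map_sub, hk, LinearMap.comp_apply, LinearMap.comp_apply, h1,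
      LinearMap.restrictScalars_apply, map_smul, smul_eq_mul, sub_self]
  embed M _ _ _ := by
    let _ : Module K M := Module.compHom M (algebraMap K R)
    have hM : IsScalarTower K R M := IsScalarTower.of_compHom K R M
    have : Module.Finite K M := Module.Finite.trans R M
    let b := Module.finBasis K M
    choose k hk using fun j => exists_coinduced φ hφ (b.coord j)
    refine ⟨_, LinearMap.pi k, (injective_iff_map_eq_zero _).mpr fun m hm => ?_⟩
    refine b.forall_coord_eq_zero_iff.mp fun j => ?_
    have h1 := hk j 1 m
    have h2 : k j m = 0 := congrFun hm j
    rw [h2, mul_zero, map_zero, one_smul] at h1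
    exact h1.symm

end Frobenius

/-! ### Radical square zero algebras of trees -/

section Tree

theorem isUnit_one_sub_mul_comm {S : Type} [Ring S] {a b : S} (h : IsUnit (1 - a * b)) :
    IsUnit (1 - b * a) := by
  obtain ⟨c, h1, h2⟩ := isUnit_iff_exists.mp h
  refine isUnit_iff_exists.mpr ⟨1 + b * c * a, ?_, ?_⟩
  · calc (1 - b * a) * (1 + b * c * a) = 1 - b * a + b * ((1 - a * b) * c) * a := by noncomm_ring
      _ = 1 := by rw [h1, mul_one, sub_add_cancel]
  · calc (1 + b * c * a) * (1 - b * a) = 1 - b * a + b * (c * (1 - a * b)) * a := by noncomm_ring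
      _ = 1 := by rw [h2, mul_one, sub_add_cancel]

theorem mem_jacobson_iff_inRad {S : Type} [Ring S] {x : S} : x ∈ Ring.jacobson S ↔ InRad S x := by
  rw [← Ideal.jacobson_bot, Ideal.mem_jacobson_iff]
  simp only [Submodule.mem_bot, sub_eq_zero]
  constructor
  · intro h y
    obtain ⟨z, hz⟩ := h (-y)
    obtain ⟨w, hw⟩ := h (z * y)
    have h1 : z * (1 - y * x) = 1 := Eq.trans (by noncomm_ring) hz
    have hz' : 1 + z * y * x = z := by
      conv_lhs => rw [← hz]
      noncomm_ring
    have h2 : w * z = 1 := by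
      rw [← hz']
      exact Eq.trans (by noncomm_ring) hw
    have h3 : w = 1 - y * x := left_inv_eq_right_inv h2 h1
    exact isUnit_iff_exists.mpr ⟨z, h3 ▸ h2, h1⟩
  · intro h y
    obtain ⟨z, -, hz⟩ := isUnit_iff_exists.mp (h (-y))
    refine ⟨z, ?_⟩
    rw [← hz]
    noncomm_ring

variable {Λ : Type} [Ring Λ]

open scoped IsMulCommutative in
theorem exists_commute_pow_eq (K : Type) [Field K] [Algebra K Λ] [FiniteDimensional K Λ]
    (w : Λ) : ∃ (m : ℕ) (y : Λ), Commute w y ∧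
    w ^ (m + 1) = w ^ (2 * (m + 1)) * y := by
  have : IsMulCommutative (Algebra.adjoin K {w}) := Algebra.isMulCommutative_adjoin K (by simp)
  let a : Algebra.adjoin K {w} := ⟨w, Algebra.subset_adjoin rfl⟩
  have : IsArtinianRing (Algebra.adjoin K {w}) := IsArtinianRing.of_finite K _
  obtain ⟨m, y, hy⟩ := IsArtinian.exists_pow_succ_smul_dvd a (1 : Algebra.adjoin K {w})
  rw [smul_eq_mul, smul_eq_mul, mul_one] at hy
  have key : ∀ k, a ^ m = a ^ (m + k) * y ^ k := fun k => by
    induction k with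
    | zero => simp
    | succ k ih =>
      calc a ^ m = a ^ m * a ^ k * y ^ k := by rw [← pow_add, ← ih]
        _ = (a ^ (m + 1) * y) * a ^ k * y ^ k := by rw [Nat.succ_eq_add_one] at hy; rw [hy]
        _ = a ^ (m + (k + 1)) * y ^ (k + 1) := by ring
  have h2 : a ^ (m + 1) = a ^ (2 * (m + 1)) * y ^ (m + 1) := by
    calc a ^ (m + 1) = a * a ^ m := by ring
      _ = a * (a ^ (m + (m + 1)) * y ^ (m + 1)) := by rw [← key]
      _ = a ^ (2 * (m + 1)) * y ^ (m + 1) := by ring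
  refine ⟨m, (y ^ (m + 1) : Algebra.adjoin K {w}), ?_, ?_⟩
  · exact congrArg Subtype.val (mul_comm a (y ^ (m + 1)))
  · exact congrArg Subtype.val h2

theorem exists_mul_eq_of_primitive (K : Type) [Field K] [Algebra K Λ] [FiniteDimensional K Λ]
    {e w : Λ} (he : IsPrimitiveIdem Λ e) (h1 : e * w = w)
    (h2 : w * e = w) (hw : ¬ IsUnit (1 - w)) : ∃ v, w * v = e := by
  obtain ⟨m, y, hy, hwy⟩ := exists_commute_pow_eq K w
  let f := w ^ (m + 1) * y
  have hf : f = y * w ^ (m + 1) := (hy.pow_left (m + 1)).eq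
  have hwf : w ^ (m + 1) * f = w ^ (m + 1) := by
    rw [← mul_assoc, ← pow_add, ← two_mul, ← hwy]
  have hff : f * f = f := by
    calc f * f = y * (w ^ (m + 1) * f) := by rw [← mul_assoc y, ← hf]
      _ = f := by rw [hwf, hf]
  have hef : e * f = f := by
    change e * (w ^ (m + 1) * y) = w ^ (m + 1) * y
    rw [pow_succ', ← mul_assoc, ← mul_assoc, h1]
  have hfe : f * e = f := by rw [hf, pow_succ, mul_assoc, mul_assoc, h2]
  have hef' : IsIdempotentElem (e - f) := by
    change (e - f) * (e - f) = e - f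
    rw [mul_sub, sub_mul, sub_mul, he.1.eq, hfe, hef, hff, sub_self, sub_zero]
  rcases he.2.2 f (e - f) hff hef' (by rw [mul_sub, hfe, hff, sub_self])
      (by rw [sub_mul, hef, hff, sub_self]) (add_sub_cancel f e) with h0 | h0
  · refine absurd (IsNilpotent.isUnit_one_sub ⟨m + 1, ?_⟩) hw
    rw [← hwf, h0, mul_zero]
  · refine ⟨w ^ m * y, ?_⟩
    rw [← mul_assoc, ← pow_succ']
    exact (sub_eq_zero.mp h0).symm

theorem IsPrimitiveIdem.exists_mul_eq (K : Type) [Field K] [Algebra K Λ] [FiniteDimensional K Λ]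
    {e u : Λ} (he : IsPrimitiveIdem Λ e) (heu : e * u = u) (hu : u ∉ Ring.jacobson Λ) :
    ∃ y, u * y = e := by
  rw [mem_jacobson_iff_inRad, InRad, not_forall] at hu
  obtain ⟨v, hv⟩ := hu
  obtain ⟨y, hy⟩ := exists_mul_eq_of_primitive K he (w := u * v * e)
    (by rw [mul_assoc, ← mul_assoc, heu]) (by rw [mul_assoc, he.1.eq]) fun h => hv (by
      have h1 := isUnit_one_sub_mul_comm h
      rw [← mul_assoc, heu] at h1
      exact isUnit_one_sub_mul_comm h1)
  exact ⟨v * e * y, Eq.trans (by noncomm_ring) hy⟩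

/-- The decomposition of the identity of a radical square zero algebra induced by a bipartition of
its quiver. -/
structure Bipartition (E : Bool → Λ) : Prop where
  add : E true + E false = 1
  mul : ∀ c, E c * E (!c) = 0
  diag : ∀ c, ∀ x ∈ Ring.jacobson Λ, E c * x * E c = 0
  off : ∀ c r, E c * r * E (!c) ∈ Ring.jacobson Λ

theorem IsTreeQuiverAlgebra.exists_bipartition {K : Type} [Field K] [Algebra K Λ]
    [FiniteDimensional K Λ] (h : IsTreeQuiverAlgebra Λ K) (hrad : RadSqZero Λ) :
    ∃ E : Bool → Λ, Bipartition E := by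
  obtain ⟨n, e, ⟨hprim, horth, hsum⟩, hloop, -, -, htree⟩ := h
  let col : Fin n → Bool := fun i => decide (htree.coloringTwo i = 0)
  have hcol : ∀ i j, (QuiverGraph Λ e).Adj i j → col j = !col i := fun i j hij => by
    have h1 := htree.coloringTwo.valid hij
    change decide _ = !decide _
    generalize htree.coloringTwo i = a at *
    generalize htree.coloringTwo j = b at *
    revert a b
    decide
  have hsq : ∀ z, InRadSq Λ z → z = 0 := fun z hz => by
    have : AddSubgroup.closure {z : Λ | ∃ a b : Λ, InRad Λ a ∧ InRad Λ b ∧ z = a * b} ≤ ⊥ := by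
      rw [AddSubgroup.closure_le]
      rintro _ ⟨a, b, ha, hb, rfl⟩
      exact hrad a b ha hb
    exact this hz
  have hadj : ∀ i j, HasArrow Λ e i j → (QuiverGraph Λ e).Adj i j := fun i j hij => by
    refine ⟨fun h => hloop i (h ▸ hij), Or.inl hij⟩
  have hdiag : ∀ i j, col i = col j → ∀ x ∈ Ring.jacobson Λ, e i * x * e j = 0 := by
    intro i j hij x hx
    by_contra hne
    have : HasArrow Λ e i j := ⟨x, mem_jacobson_iff_inRad.mp hx, fun h => hne (hsq _ h)⟩
    have := hcol i j (hadj i j this)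
    rw [hij] at this
    exact Bool.eq_not.mp this rfl
  have hoff : ∀ i j, col i ≠ col j → ∀ r, e i * r * e j ∈ Ring.jacobson Λ := by
    intro i j hij r
    by_contra hu
    have hi := (hprim i).1.eq
    have hj := (hprim j).1.eq
    obtain ⟨y, hy⟩ := (hprim i).exists_mul_eq K (by rw [← mul_assoc, ← mul_assoc, hi]) hu
    have : Nontrivial (Fin n) := ⟨i, j, fun h => hij (h ▸ rfl)⟩
    obtain ⟨k, hk⟩ := htree.connected.preconnected.exists_adj_of_nontrivial i
    have hkj : col k = col j := by
      rw [hcol i k hk, ← Bool.eq_not.mpr hij.symm]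
    rcases hk.2 with ⟨x, hx, hx'⟩ | ⟨x, hx, hx'⟩
    · refine hx' ?_
      have h1 : e i * x * e k = 0 := by
        have h2 := hdiag j k hkj.symm (y * x)
          (Ideal.mul_mem_left _ _ (mem_jacobson_iff_inRad.mpr hx))
        calc e i * x * e k = e i * r * (e j * (y * x) * e k) := by
              conv_lhs => rw [← hy]
              noncomm_ring
          _ = 0 := by rw [h2, mul_zero]
      rw [h1]
      exact zero_mem _
    · refine hx' ?_
      have h1 : e k * x * e i = 0 := by
        have h2 := hdiag k j hkj (x * (e i * r))
          (Ideal.mul_mem_right _ _ (mem_jacobson_iff_inRad.mpr hx))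
        calc e k * x * e i = e k * (x * (e i * r)) * e j * y := by
              conv_lhs => rw [← hy]
              noncomm_ring
          _ = 0 := by rw [h2, zero_mul]
      rw [h1]
      exact zero_mem _
  refine ⟨fun c => ∑ i with col i = c, e i, ?_, fun c => ?_, fun c x hx => ?_, fun c r => ?_⟩
  · rw [← hsum, ← Finset.sum_filter_add_sum_filter_not Finset.univ fun i => col i = true]
    simp
  · rw [Finset.sum_mul_sum]
    refine Finset.sum_eq_zero fun i hi => Finset.sum_eq_zero fun j hj => horth i j ?_
    rintro rfl
    rw [Finset.mem_filter] at hi hj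
    exact Bool.eq_not.mp (hi.2.symm.trans hj.2) rfl
  · rw [Finset.sum_mul, Finset.sum_mul_sum]
    refine Finset.sum_eq_zero fun i hi => Finset.sum_eq_zero fun j hj => hdiag i j ?_ x hx
    rw [(Finset.mem_filter.mp hi).2, (Finset.mem_filter.mp hj).2]
  · rw [Finset.sum_mul, Finset.sum_mul_sum]
    refine sum_mem fun i hi => sum_mem fun j hj => hoff i j ?_ r
    rw [(Finset.mem_filter.mp hi).2, (Finset.mem_filter.mp hj).2]
    exact Bool.eq_not.mp (Bool.not_not c).symm

end Tree

/-! ### The trivial extension -/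

section TrivialExtension

open MulOpposite

variable {K Λ : Type} [Field K] [Ring Λ] [Algebra K Λ]

instance : Module K (DualBimodule K Λ) := inferInstanceAs (Module K (Λ →ₗ[K] K))

instance : IsScalarTower K Λ (DualBimodule K Λ) where
  smul_assoc k a f := by
    change Λ →ₗ[K] K at f
    refine LinearMap.ext fun x => ?_
    change f (x * (k • a)) = k • f (x * a)
    rw [mul_smul_comm, map_smul]

instance : IsScalarTower K Λᵐᵒᵖ (DualBimodule K Λ) where
  smul_assoc k a f := by
    change Λ →ₗ[K] K at f
    refine LinearMap.ext fun x => ?_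
    change f ((k • a.unop) * x) = k • f (a.unop * x)
    rw [smul_mul_assoc, map_smul]

instance : Algebra K (TrivialExtension K Λ) :=
  inferInstanceAs (Algebra K (TrivSqZeroExt Λ (DualBimodule K Λ)))

namespace TrivialExtension

/-- The element `(a, f)` of the trivial extension. -/
def mk (a : Λ) (f : Λ →ₗ[K] K) : TrivialExtension K Λ := (a, f)

/-- The algebra component of an element of the trivial extension. -/
def base : TrivialExtension K Λ →ₗ[K] Λ where
  toFun x := x.1
  map_add' _ _ := rfl
  map_smul' _ _ := rfl

/-- The dual component of an element of the trivial extension. -/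
def functional : TrivialExtension K Λ →ₗ[K] Λ →ₗ[K] K where
  toFun x := x.2
  map_add' _ _ := rfl
  map_smul' _ _ := rfl

@[simp] theorem base_mk (a : Λ) (f : Λ →ₗ[K] K) : base (mk a f) = a := rfl

@[simp] theorem functional_mk (a : Λ) (f : Λ →ₗ[K] K) : functional (mk a f) = f := rfl

@[simp] theorem base_one : base (1 : TrivialExtension K Λ) = 1 := rfl

@[simp] theorem functional_one : functional (1 : TrivialExtension K Λ) = 0 := rfl

@[simp] theorem base_mul (x y : TrivialExtension K Λ) : base (x * y) = base x * base y := rfl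

@[simp] theorem functional_mul (x y : TrivialExtension K Λ) (z : Λ) :
    functional (x * y) z = functional y (z * base x) + functional x (base y * z) := rfl

theorem ext {x y : TrivialExtension K Λ} (h : base x = base y)
    (h' : ∀ z, functional x z = functional y z) : x = y :=
  Prod.ext h (LinearMap.ext h')

instance [FiniteDimensional K Λ] : FiniteDimensional K (TrivialExtension K Λ) :=
  Module.Finite.of_injective ((base (K := K) (Λ := Λ)).prod functional) fun _ _ h => h

theorem isUnit_iff {x : TrivialExtension K Λ} : IsUnit x ↔ IsUnit (base x) :=
  TrivSqZeroExt.isUnit_iff_isUnit_fst (R := Λ) (M := DualBimodule K Λ)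

theorem mem_jacobson_op {x : (TrivialExtension K Λ)ᵐᵒᵖ} :
    x ∈ Ring.jacobson (TrivialExtension K Λ)ᵐᵒᵖ ↔ base x.unop ∈ Ring.jacobson Λ := by
  rw [mem_jacobson_iff_inRad, mem_jacobson_iff_inRad]
  constructor
  · intro h a
    have h1 := isUnit_iff.mp (isUnit_unop.mpr (h (op (mk a 0))))
    rw [MulOpposite.unop_sub, MulOpposite.unop_mul, map_sub] at h1
    exact isUnit_one_sub_mul_comm h1
  · intro h y
    refine isUnit_unop.mp (isUnit_iff.mpr ?_)
    rw [MulOpposite.unop_sub, MulOpposite.unop_mul, map_sub]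
    exact isUnit_one_sub_mul_comm (h _)

theorem quasiFrobenius_op [FiniteDimensional K Λ] :
    QuasiFrobenius (TrivialExtension K Λ)ᵐᵒᵖ := by
  refine quasiFrobenius_of_form (K := K)
    (LinearMap.applyₗ (1 : Λ) ∘ₗ functional ∘ₗ (opLinearEquiv K).symm.toLinearMap) fun b hb => ?_
  have h : ∀ y : TrivialExtension K Λ, functional (b.unop * y) 1 = 0 := fun y => hb (op y)
  refine unop_injective (ext ?_ fun z => ?_)
  · refine (Module.forall_dual_apply_eq_zero_iff K _).mp fun g => ?_
    simpa using h (mk 0 g)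
  · simpa using h (mk z 0)

end TrivialExtension

theorem Bipartition.mul_self {E : Bool → Λ} (hE : Bipartition E) (c : Bool) : E c * E c = E c := by
  have h : E c + E (!c) = 1 := by
    cases c
    · exact (add_comm _ _).trans hE.add
    · exact hE.add
  rw [← add_zero (E c * E c), ← hE.mul c, ← mul_add, h, mul_one]

open TrivialExtension in
theorem Bipartition.twoColoured {E : Bool → Λ} (hE : Bipartition E) :
    TwoColoured (TrivialExtension K Λ)ᵐᵒᵖ fun c => op (TrivialExtension.mk (E c) 0) := by
  have hbase : ∀ c d (r : (TrivialExtension K Λ)ᵐᵒᵖ),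
      base (op (TrivialExtension.mk (E c) 0) * r * op (TrivialExtension.mk (E d) 0)).unop =
        E d * base r.unop * E c := fun c d r => by
    simp [mul_assoc]
  have hfun : ∀ c d (r : (TrivialExtension K Λ)ᵐᵒᵖ) z,
      functional (op (TrivialExtension.mk (E c) 0) * r * op (TrivialExtension.mk (E d) 0)).unop z =
        functional r.unop (E c * z * E d) := fun c d r z => by
    simp [mul_assoc]
  refine ⟨?_, fun c => ?_, fun c r => ?_, fun c x hx y hy => ?_, fun c x hx y hy => ?_,
    fun c r h => ?_⟩
  · refine unop_injective (TrivialExtension.ext ?_ fun z => ?_)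
    · simpa using hE.add
    · simp
  · refine unop_injective (TrivialExtension.ext ?_ fun z => ?_)
    · simpa using hE.mul (!c)
    · simp
  · rw [mem_jacobson_op, hbase]
    simpa using hE.off (!c) (base r.unop)
  · rw [mem_jacobson_op] at hx hy
    refine unop_injective (TrivialExtension.ext ?_ fun z => ?_)
    · rw [MulOpposite.unop_mul, base_mul, hbase, hE.diag c _ hy, zero_mul, MulOpposite.unop_zero,
        map_zero]
    · rw [MulOpposite.unop_mul, functional_mul, hbase, hfun, hE.diag c _ hy,
        hE.diag c _ (Ideal.mul_mem_right _ _ hx)]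
      simp
  · rw [mem_jacobson_op] at hx hy
    refine unop_injective (TrivialExtension.ext ?_ fun z => ?_)
    · rw [MulOpposite.unop_mul, base_mul, hbase, hE.diag c _ hx, mul_zero, MulOpposite.unop_zero,
        map_zero]
    · rw [MulOpposite.unop_mul, functional_mul, hbase, hfun, hE.diag c _ hx,
        hE.diag c _ (Ideal.mul_mem_left _ _ hy)]
      simp
  · set w := op (TrivialExtension.mk (E (!c)) 0) * r * op (TrivialExtension.mk (E c) 0) with hw
    have h' : ∀ x : TrivialExtension K Λ, base x ∈ Ring.jacobson Λ → w.unop * x = 0 :=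
      fun x hx => op_injective (h (op x) (mem_jacobson_op.mpr hx))
    refine unop_injective (TrivialExtension.ext ?_ fun z => ?_)
    · refine (Module.forall_dual_apply_eq_zero_iff K _).mp fun g => ?_
      have h1 := congrArg (fun x => functional x 1) (h' (TrivialExtension.mk 0 g) (zero_mem _))
      simpa using h1
    · have h1 := congrArg (fun x => functional x 1)
        (h' (TrivialExtension.mk (E (!c) * z * E c) 0) (by
        simpa using hE.off (!c) z))
      have h2 : functional w.unop (E (!c) * z * E c) = 0 := by simpa using h1
      rw [hw, hfun, ← mul_assoc, ← mul_assoc, hE.mul_self, mul_assoc, hE.mul_self] at h2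
      rw [hw, hfun, h2]
      simp

end TrivialExtension

/-- Theorem 4.8(2) of the paper.  Let `Λ` be a
finite-dimensional algebra over an algebraically closed field presented by a
tree quiver with radical square zero, and let `T(Λ) = Λ ⋉ DΛ` be its trivial
extension.  If `T(Λ)` is τ-tilting-finite, then `T(Λ)` is
representation-finite. -/
theorem tau_tilting_finite_trivial_extension_of_tree_radical_square_zero
    (K Λ : Type) [Field K] [IsAlgClosed K] [Ring Λ] [Algebra K Λ] [FiniteDimensional K Λ]
    (htree : IsTreeQuiverAlgebra Λ K)
    (hrad : RadSqZero Λ)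
    (ht : IsTauTiltingFinite (TrivialExtension K Λ)) :
    IsRepFinite (TrivialExtension K Λ) := by
  obtain ⟨E, hE⟩ := htree.exists_bipartition hrad
  have : QuasiFrobenius (TrivialExtension K Λ)ᵐᵒᵖ := TrivialExtension.quasiFrobenius_op
  exact hE.twoColoured.isRepFiniteRing K ht

end PaperSilting
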